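/- The family gamma -> (1/T - gamma omega)/(1/T - gamma(alpha omega)), indexed by Gamma~ = Gamma/{±I}, is multipliable, and its product u_alpha(1/T) satisfies |u_alpha(1/T) - (pi^{-1} + 1 + pi)| < 3^{-1}, where pi = 1/T (so pi^{-1} = T). (Part of the Proposition in Section 8.2 of the paper; this is the value at the cusp 1/T.) -/

import Mathlib

open Polynomial Matrix
open scoped Classical

/-- The absolute value on `K_∞ = F₃((π))`: `|x| = 3^{-v_∞(x)}`. -/
noncomputable def absK3 (x : LaurentSeries (ZMod 3)) : ℝ :=
  if x = 0 then 0 else (3 : ℝ) ^ (-(HahnSeries.order x))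

/-- The element `T = π⁻¹` of `K_∞ = F₃((π))`. -/
noncomputable def Tel3 : LaurentSeries (ZMod 3) :=
  HahnSeries.single (-1 : ℤ) 1

/-- The embedding `A = F₃[T] → C`, sending `T` to `π⁻¹`. -/
noncomputable def polyEmb3 (C : Type*) [NormedField C]
    [Algebra (LaurentSeries (ZMod 3)) C] : Polynomial (ZMod 3) →+* C :=
  (algebraMap (LaurentSeries (ZMod 3)) C).comp (Polynomial.aeval Tel3).toRingHom

/-- The action of a matrix over `A = F₃[T]` on `C` by fractional linear
transformations. -/
noncomputable def act3 {C : Type*} [NormedField C] [Algebra (LaurentSeries (ZMod 3)) C]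
    (g : Matrix (Fin 2) (Fin 2) (Polynomial (ZMod 3))) (z : C) : C :=
  (polyEmb3 C (g 0 0) * z + polyEmb3 C (g 0 1)) /
    (polyEmb3 C (g 1 0) * z + polyEmb3 C (g 1 1))

/-- `Γ = Γ₀(T³-T²) = {[[a,b],[c,d]] : a,b,c,d ∈ F₃[T], ad-bc ∈ F₃ˣ, (T³-T²) ∣ c}`. -/
def Gamma0TTT : Set (Matrix (Fin 2) (Fin 2) (Polynomial (ZMod 3))) :=
  {g | (∃ u : ZMod 3, u ≠ 0 ∧ g.det = Polynomial.C u) ∧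
    ((Polynomial.X : Polynomial (ZMod 3)) ^ 3 - Polynomial.X ^ 2) ∣ g 1 0}

/-- The matrix `α = [[T³+2T²+2T+2, 2T+1],[T⁴+T³+T², 2T²+2T+1]] ∈ Γ₀(T³-T²)`. -/
noncomputable def alpha3 : Matrix (Fin 2) (Fin 2) (Polynomial (ZMod 3)) :=
  !![Polynomial.X ^ 3 + 2 * Polynomial.X ^ 2 + 2 * Polynomial.X + 2, 2 * Polynomial.X + 1;
     Polynomial.X ^ 4 + Polynomial.X ^ 3 + Polynomial.X ^ 2, 2 * Polynomial.X ^ 2 + 2 * Polynomial.X + 1]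

/-- The equivalence relation on `Γ` identifying `γ` and `-γ`;  the quotient
`Quotient pmSetoid` is `Γ~ = Γ/{±I}`. -/
def pmSetoid : Setoid ↥Gamma0TTT where
  r γ δ := δ.val = γ.val ∨ δ.val = -γ.val
  iseqv := by
    constructor
    · intro γ
      exact Or.inl rfl
    · rintro γ δ (h | h)
      · exact Or.inl h.symm
      · exact Or.inr (by rw [h, neg_neg])
    · rintro γ δ ε (h | h) (h' | h')
      · exact Or.inl (h'.trans h)
      · exact Or.inr (by rw [h', h])
      · exact Or.inr (h'.trans h)
      · exact Or.inl (by rw [h', h, neg_neg])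

section UltrametricProducts

variable {ι K : Type*} [NormedField K] [IsUltrametricDist K]

theorem norm_prod_sub_one_le {f : ι → K} {δ : ℝ} (h0 : 0 ≤ δ) (h1 : δ ≤ 1) (s : Finset ι)
    (h : ∀ i ∈ s, ‖f i - 1‖ ≤ δ) : ‖∏ i ∈ s, f i - 1‖ ≤ δ := by
  induction s using Finset.induction_on with
  | empty => simpa using h0
  | insert a s ha ih =>
    rw [Finset.prod_insert ha]
    have hs := ih fun i hi => h i (Finset.mem_insert_of_mem hi)
    have hf := h a (Finset.mem_insert_self a s)
    have hg : ‖∏ i ∈ s, f i‖ ≤ 1 := by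
      have : ∏ i ∈ s, f i = (∏ i ∈ s, f i - 1) + 1 := by ring
      rw [this]
      refine (IsUltrametricDist.norm_add_le_max _ _).trans (max_le (hs.trans h1) ?_)
      simp
    have e : f a * ∏ i ∈ s, f i - 1 = (f a - 1) * ∏ i ∈ s, f i + (∏ i ∈ s, f i - 1) := by ring
    rw [e]
    refine (IsUltrametricDist.norm_add_le_max _ _).trans (max_le ?_ hs)
    rw [norm_mul]
    calc ‖f a - 1‖ * ‖∏ i ∈ s, f i‖ ≤ δ * 1 := by gcongr
      _ = δ := mul_one δ

theorem norm_prod_sub_prod_le {f : ι → K} {δ : ℝ} (h0 : 0 ≤ δ) (h1 : δ ≤ 1) {s t : Finset ι}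
    (hst : s ⊆ t) (h : ∀ i ∉ s, ‖f i - 1‖ ≤ δ) :
    ‖∏ i ∈ t, f i - ∏ i ∈ s, f i‖ ≤ δ * ‖∏ i ∈ s, f i‖ := by
  rw [← Finset.prod_sdiff hst]
  have e : (∏ i ∈ t \ s, f i) * ∏ i ∈ s, f i - ∏ i ∈ s, f i
      = (∏ i ∈ t \ s, f i - 1) * ∏ i ∈ s, f i := by ring
  rw [e, norm_mul]
  gcongr
  exact norm_prod_sub_one_le h0 h1 _ fun i hi => h i (Finset.mem_sdiff.1 hi).2

theorem multipliable_of_finite_norm_sub_one [CompleteSpace K] {f : ι → K}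
    (hf : ∀ ε > 0, {i | ε ≤ ‖f i - 1‖}.Finite) : Multipliable f := by
  set s₀ : Finset ι := (hf 1 one_pos).toFinset with hs₀
  have h₀ : ∀ i ∉ s₀, ‖f i - 1‖ ≤ 1 := fun i hi => by
    simp only [hs₀, Set.Finite.mem_toFinset, Set.mem_ofPred_eq, not_le] at hi
    exact hi.le
  have hbound : ∀ s, s₀ ⊆ s → ‖∏ i ∈ s, f i‖ ≤ ‖∏ i ∈ s₀, f i‖ := fun s hs => by
    have e : ∏ i ∈ s, f i = (∏ i ∈ s, f i - ∏ i ∈ s₀, f i) + ∏ i ∈ s₀, f i := by ring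
    rw [e]
    refine (IsUltrametricDist.norm_add_le_max _ _).trans (max_le ?_ le_rfl)
    simpa using norm_prod_sub_prod_le zero_le_one le_rfl hs h₀
  have hcauchy : CauchySeq fun s : Finset ι => ∏ i ∈ s, f i := by
    rw [Metric.cauchySeq_iff']
    intro ε hε
    set B := ‖∏ i ∈ s₀, f i‖ with hB
    have hB0 : 0 ≤ B := norm_nonneg _
    set δ := min 1 (ε / (2 * (B + 1))) with hδ
    have hδ0 : 0 < δ := lt_min one_pos (by positivity)
    refine ⟨s₀ ∪ (hf δ hδ0).toFinset, fun s hs => ?_⟩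
    rw [dist_eq_norm]
    have hout : ∀ i ∉ s₀ ∪ (hf δ hδ0).toFinset, ‖f i - 1‖ ≤ δ := fun i hi => by
      simp only [Finset.mem_union, Set.Finite.mem_toFinset, Set.mem_ofPred_eq, not_or, not_le] at hi
      exact hi.2.le
    refine (norm_prod_sub_prod_le hδ0.le (min_le_left _ _) hs hout).trans_lt ?_
    calc δ * ‖∏ i ∈ s₀ ∪ (hf δ hδ0).toFinset, f i‖
        ≤ ε / (2 * (B + 1)) * B := by
          gcongr
          · exact min_le_right _ _
          · exact hbound _ Finset.subset_union_left
      _ < ε := by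
          rw [div_mul_eq_mul_div, div_lt_iff₀ (by positivity)]
          nlinarith
  obtain ⟨P, hP⟩ := cauchySeq_tendsto_of_complete hcauchy
  exact ⟨P, by simpa [HasProd] using hP⟩

theorem norm_tprod_sub_le {f : ι → K} (hf : Multipliable f) {δ : ℝ} (h0 : 0 ≤ δ) (h1 : δ ≤ 1)
    (s : Finset ι) (h : ∀ i ∉ s, ‖f i - 1‖ ≤ δ) :
    ‖∏' i, f i - ∏ i ∈ s, f i‖ ≤ δ * ‖∏ i ∈ s, f i‖ := by
  have hP := hf.hasProd
  simp only [HasProd, SummationFilter.unconditional_filter] at hP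
  refine le_of_tendsto (hP.sub_const _).norm ?_
  filter_upwards [Filter.eventually_ge_atTop s] with t ht
  exact norm_prod_sub_prod_le h0 h1 ht h

end UltrametricProducts

section PolynomialNorm

variable {K : Type*} [NormedField K] {φ : (ZMod 3)[X] →+* K}

theorem zmodThree_sq_eq_one : ∀ u : ZMod 3, u ≠ 0 → u ^ 2 = 1 := by decide

theorem zmodThree_sq_add_sq : ∀ a b : ZMod 3, b ≠ 0 ∨ a ≠ 0 → a ^ 2 + b ^ 2 ≠ 0 := by decide

theorem norm_map_C {u : ZMod 3} (hu : u ≠ 0) : ‖φ (Polynomial.C u)‖ = 1 := by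
  have h : ‖φ (Polynomial.C u)‖ ^ 2 = 1 := by
    rw [← norm_pow, ← map_pow, ← map_pow, zmodThree_sq_eq_one u hu, map_one, map_one, norm_one]
  exact (pow_eq_one_iff_of_nonneg (norm_nonneg _) two_ne_zero).1 h

theorem norm_map_C_le (u : ZMod 3) : ‖φ (Polynomial.C u)‖ ≤ 1 := by
  rcases eq_or_ne u 0 with rfl | hu
  · simp
  · exact (norm_map_C hu).le

variable [IsUltrametricDist K] (hφ : ‖φ X‖ = 3)

include hφ

theorem norm_map_le_of_coeff {p : (ZMod 3)[X]} {n : ℕ} {r : ℝ} (hr : 0 ≤ r)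
    (hp : p.natDegree ≤ n) (h : ∀ i ≤ n, p.coeff i ≠ 0 → (3 : ℝ) ^ i ≤ r) : ‖φ p‖ ≤ r := by
  rw [p.as_sum_range' (n + 1) (Nat.lt_succ_of_le hp), map_sum]
  refine IsUltrametricDist.norm_sum_le_of_forall_le_of_nonneg hr fun i hi => ?_
  rw [← Polynomial.C_mul_X_pow_eq_monomial, map_mul, map_pow, norm_mul, norm_pow, hφ]
  by_cases h0 : p.coeff i = 0
  · simpa [h0] using hr
  · rw [norm_map_C h0, one_mul]
    exact h i (Nat.lt_succ_iff.1 (Finset.mem_range.1 hi)) h0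

theorem norm_map_le {p : (ZMod 3)[X]} {n : ℕ} (hp : p.natDegree ≤ n) : ‖φ p‖ ≤ 3 ^ n :=
  norm_map_le_of_coeff hφ (by positivity) hp fun i hi _ => by gcongr; norm_num

theorem norm_map_eq {p : (ZMod 3)[X]} (hp : p ≠ 0) : ‖φ p‖ = 3 ^ p.natDegree := by
  have hlead : ‖φ (Polynomial.C p.leadingCoeff * X ^ p.natDegree)‖ = 3 ^ p.natDegree := by
    rw [map_mul, norm_mul, norm_map_C (Polynomial.leadingCoeff_ne_zero.2 hp), map_pow, norm_pow,
      hφ, one_mul]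
  have hlt : ‖φ p.eraseLead‖ < 3 ^ p.natDegree := by
    refine (norm_map_le_of_coeff hφ (n := p.natDegree) (r := (3 : ℝ) ^ p.natDegree / 3)
      (by positivity) (p.eraseLead_natDegree_le_aux) fun i hi h0 => ?_).trans_lt ?_
    · rcases hi.lt_or_eq with h | rfl
      · rw [le_div_iff₀ (by norm_num), ← pow_succ]
        exact pow_le_pow_right₀ (by norm_num) h
      · simp at h0
    · have : (0 : ℝ) < 3 ^ p.natDegree := by positivity
      linarith
  conv_lhs => rw [← p.eraseLead_add_C_mul_X_pow]
  rw [map_add, IsUltrametricDist.norm_add_eq_max_of_norm_ne_norm (by rw [hlead]; exact hlt.ne),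
    hlead, max_eq_right hlt.le]

variable {ρ : K} (hρ : ρ ^ 2 + 1 = 0)

omit hφ [IsUltrametricDist K] in
include hρ in
theorem norm_sqrt_neg_one : ‖ρ‖ = 1 := by
  have h : ‖ρ‖ ^ 2 = 1 := by
    rw [← norm_pow, eq_neg_of_add_eq_zero_left hρ, norm_neg, norm_one]
  exact (pow_eq_one_iff_of_nonneg (norm_nonneg _) two_ne_zero).1 h

include hρ in
theorem norm_map_mul_add {x y : (ZMod 3)[X]} (hy : y ≠ 0) :
    ‖φ x * ρ + φ y‖ = 3 ^ max x.natDegree y.natDegree := by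
  set n := max x.natDegree y.natDegree with hn
  have hx' := norm_map_le hφ (le_max_left x.natDegree y.natDegree)
  have hy' := norm_map_le hφ (le_max_right x.natDegree y.natDegree)
  rw [← hn] at hx' hy'
  have hρ1 := norm_sqrt_neg_one hρ
  have hle : ‖φ x * ρ + φ y‖ ≤ 3 ^ n :=
    (IsUltrametricDist.norm_add_le_max _ _).trans (max_le (by simpa [hρ1] using hx') hy')
  have hle' : ‖-(φ x * ρ) + φ y‖ ≤ 3 ^ n :=
    (IsUltrametricDist.norm_add_le_max _ _).trans
      (max_le (by simpa [hρ1] using hx') hy')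
  have hcoeff : (x ^ 2 + y ^ 2).coeff (2 * n) ≠ 0 := by
    rw [Polynomial.coeff_add, Polynomial.coeff_pow_of_natDegree_le (le_max_left _ _),
      Polynomial.coeff_pow_of_natDegree_le (le_max_right _ _)]
    apply zmodThree_sq_add_sq
    rcases le_total x.natDegree y.natDegree with h | h
    · left
      rw [max_eq_right h]
      exact Polynomial.leadingCoeff_ne_zero.2 hy
    · by_cases hx : x = 0
      · left
        subst hx
        have h0 : y.natDegree = 0 := by simpa using h
        have : max (Polynomial.natDegree (0 : (ZMod 3)[X])) y.natDegree = y.natDegree := by simp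
        rw [this]
        exact Polynomial.leadingCoeff_ne_zero.2 hy
      · right
        rw [max_eq_left h]
        exact Polynomial.leadingCoeff_ne_zero.2 hx
  have hdeg : (x ^ 2 + y ^ 2).natDegree = 2 * n := by
    refine le_antisymm ?_ (Polynomial.le_natDegree_of_ne_zero hcoeff)
    refine (Polynomial.natDegree_add_le _ _).trans (max_le ?_ ?_)
    · exact Polynomial.natDegree_pow_le.trans (by gcongr; exact le_max_left _ _)
    · exact Polynomial.natDegree_pow_le.trans (by gcongr; exact le_max_right _ _)
  have hne : x ^ 2 + y ^ 2 ≠ 0 := fun h => hcoeff (by rw [h]; simp)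
  have hprod : ‖φ x * ρ + φ y‖ * ‖-(φ x * ρ) + φ y‖ = 3 ^ n * 3 ^ n := by
    have e : (φ x * ρ + φ y) * (-(φ x * ρ) + φ y) = φ (x ^ 2 + y ^ 2) := by
      rw [map_add, map_pow, map_pow]
      linear_combination -φ x ^ 2 * hρ
    rw [← norm_mul, e, norm_map_eq hφ hne, hdeg, two_mul, pow_add]
  refine le_antisymm hle ?_
  by_contra! hlt
  have : ‖φ x * ρ + φ y‖ * ‖-(φ x * ρ) + φ y‖ < 3 ^ n * 3 ^ n :=
    mul_lt_mul_of_lt_of_le_of_nonneg_of_pos hlt hle' (norm_nonneg _) (by positivity)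
  exact this.ne hprod

end PolynomialNorm

section CoefficientLists

/-- The polynomial over `F₃` with a given list of coefficients, constant term first. -/
noncomputable def ofL : List (ZMod 3) → (ZMod 3)[X]
  | [] => 0
  | a :: p => Polynomial.C a + X * ofL p

def addL : List (ZMod 3) → List (ZMod 3) → List (ZMod 3)
  | [], q => q
  | p, [] => p
  | a :: p, b :: q => (a + b) :: addL p q

def scaleL (c : ZMod 3) (p : List (ZMod 3)) : List (ZMod 3) := p.map (c * ·)

def mulL : List (ZMod 3) → List (ZMod 3) → List (ZMod 3)
  | [], _ => []
  | a :: p, q => addL (scaleL a q) (0 :: mulL p q)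

/-- Equality of coefficient lists up to trailing zeros. -/
def eqvL : List (ZMod 3) → List (ZMod 3) → Bool
  | [], q => q.all (· = 0)
  | p, [] => p.all (· = 0)
  | a :: p, b :: q => a = b && eqvL p q

/-- Removal of trailing zeros. -/
def trimL : List (ZMod 3) → List (ZMod 3)
  | [] => []
  | a :: p => if a = 0 ∧ trimL p = [] then [] else a :: trimL p

@[simp] theorem ofL_nil : ofL [] = 0 := rfl

@[simp] theorem ofL_cons (a : ZMod 3) (p : List (ZMod 3)) :
    ofL (a :: p) = Polynomial.C a + X * ofL p := rfl

@[simp] theorem ofL_addL (p q : List (ZMod 3)) : ofL (addL p q) = ofL p + ofL q := by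
  induction p generalizing q with
  | nil => simp [addL]
  | cons a p ih =>
    cases q with
    | nil => simp [addL]
    | cons b q => simp only [addL, ofL_cons, ih, Polynomial.C_add]; ring

@[simp] theorem ofL_scaleL (c : ZMod 3) (p : List (ZMod 3)) :
    ofL (scaleL c p) = Polynomial.C c * ofL p := by
  induction p with
  | nil => simp [scaleL]
  | cons a p ih =>
    simp only [scaleL, List.map_cons, ofL_cons, Polynomial.C_mul] at ih ⊢
    rw [ih]; ring

@[simp] theorem ofL_mulL (p q : List (ZMod 3)) : ofL (mulL p q) = ofL p * ofL q := by
  induction p with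
  | nil => simp [mulL]
  | cons a p ih => simp only [mulL, ofL_addL, ofL_scaleL, ofL_cons, ih, Polynomial.C_0]; ring

theorem ofL_eq_zero {p : List (ZMod 3)} (h : p.all (· = 0) = true) : ofL p = 0 := by
  induction p with
  | nil => rfl
  | cons a p ih =>
    simp only [List.all_cons, Bool.and_eq_true, decide_eq_true_eq] at h
    simp [h.1, ih h.2]

theorem ofL_eq_of_eqvL {p q : List (ZMod 3)} (h : eqvL p q = true) : ofL p = ofL q := by
  induction p generalizing q with
  | nil => exact (ofL_eq_zero (by simpa [eqvL] using h)).symm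
  | cons a p ih =>
    cases q with
    | nil => exact ofL_eq_zero (by simpa [eqvL] using h)
    | cons b q =>
      simp only [eqvL, Bool.and_eq_true, decide_eq_true_eq] at h
      simp [h.1, ih h.2]

@[simp] theorem ofL_trimL (p : List (ZMod 3)) : ofL (trimL p) = ofL p := by
  induction p with
  | nil => rfl
  | cons a p ih =>
    rw [trimL]
    split_ifs with h
    · rw [ofL_cons, ← ih, h.1, h.2]; simp
    · rw [ofL_cons, ofL_cons, ih]

theorem coeff_ofL (p : List (ZMod 3)) (k : ℕ) : (ofL p).coeff k = p.getD k 0 := by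
  induction p generalizing k with
  | nil => simp
  | cons a p ih =>
    cases k with
    | zero => simp
    | succ k => simp [ih]

theorem natDegree_ofL_le {p : List (ZMod 3)} {n : ℕ} (h : p.length ≤ n + 1) :
    (ofL p).natDegree ≤ n := by
  refine Polynomial.natDegree_le_iff_coeff_eq_zero.2 fun k hk => ?_
  rw [coeff_ofL, List.getD_eq_default _ _ (by omega)]

theorem ofL_map_coeff {p : (ZMod 3)[X]} {n : ℕ} (h : ∀ i, n ≤ i → p.coeff i = 0) :
    ofL ((List.range n).map p.coeff) = p := by
  ext k
  rw [coeff_ofL]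
  rcases lt_or_ge k n with hk | hk
  · simp [List.getD, hk]
  · rw [h k hk, List.getD_eq_default _ _ (by simpa using hk)]

end CoefficientLists

section Search

/-- Coefficients of `d (1 - X - X²) - e (X² + X³ + X⁴)`. -/
def colA (e d : List (ZMod 3)) (k : ℕ) : ZMod 3 :=
  d.getD k 0 - (0 :: d).getD k 0 - (0 :: 0 :: d).getD k 0 - (0 :: 0 :: e).getD k 0
    - (0 :: 0 :: 0 :: e).getD k 0 - (0 :: 0 :: 0 :: 0 :: e).getD k 0

/-- Coefficients of `d (X + X² + X³) + e (X + X⁴ + X⁵)`. -/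
def colB (e d : List (ZMod 3)) (k : ℕ) : ZMod 3 :=
  (0 :: d).getD k 0 + (0 :: 0 :: d).getD k 0 + (0 :: 0 :: 0 :: d).getD k 0
    + (0 :: e).getD k 0 + (0 :: 0 :: 0 :: 0 :: e).getD k 0 + (0 :: 0 :: 0 :: 0 :: 0 :: e).getD k 0

/-- Coefficients of the product of a polynomial with the power series with coefficients `A`. -/
def convCoeff : List (ZMod 3) → (ℕ → ZMod 3) → ℕ → ZMod 3
  | [], _, _ => 0
  | c :: _, A, 0 => c * A 0
  | c :: x, A, k + 1 => c * A (k + 1) + convCoeff x A k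

/-- Coefficients of the determinant relation, see `coeff_relation`. -/
def relCoeff (x y e d : List (ZMod 3)) (k : ℕ) : ZMod 3 :=
  convCoeff x (colA e d) k - convCoeff y (colB e d) k

theorem coeff_ofL_mul (x : List (ZMod 3)) {p : (ZMod 3)[X]} {A : ℕ → ZMod 3}
    (hA : ∀ k, p.coeff k = A k) (k : ℕ) : (ofL x * p).coeff k = convCoeff x A k := by
  induction x generalizing k with
  | nil => simp [convCoeff]
  | cons c x ih =>
    have e : ofL (c :: x) * p = Polynomial.C c * p + X * (ofL x * p) := by
      rw [ofL_cons]; ring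
    cases k with
    | zero => rw [e]; simp [convCoeff, hA]
    | succ k => rw [e]; simp [convCoeff, hA, ih]

theorem coeff_relation (x y e d : List (ZMod 3)) (k : ℕ) :
    (ofL x * (ofL d * (1 - X - X ^ 2) - ofL e * (X ^ 2 + X ^ 3 + X ^ 4))
      - ofL y * (ofL d * (X + X ^ 2 + X ^ 3) + ofL e * (X + X ^ 4 + X ^ 5))).coeff k
      = relCoeff x y e d k := by
  rw [Polynomial.coeff_sub, relCoeff]
  congr 1
  · refine coeff_ofL_mul x (fun k => ?_) k
    simp only [colA, ← coeff_ofL, ← Polynomial.coeff_sub]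
    congr 1
    simp only [ofL_cons, Polynomial.C_0]
    ring
  · refine coeff_ofL_mul y (fun k => ?_) k
    simp only [colB, ← coeff_ofL, ← Polynomial.coeff_add]
    congr 1
    simp only [ofL_cons, Polynomial.C_0]
    ring

/-- Coefficients of a matrix `γ = [[a, b], [(X³ - X²) e, d]]` in `Γ`, together with the row
`(X x, y) = (-X, 1) γ α`. -/
structure Entry where
  a : List (ZMod 3)
  b : List (ZMod 3)
  e : List (ZMod 3)
  d : List (ZMod 3)
  x : List (ZMod 3)
  y : List (ZMod 3)

/-- The classes in `Γ/{±1}` whose factor is not within `1/27` of `1`. -/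
def table : List Entry :=
  [⟨[1], [2, 1], [], [1], [1, 2, 0, 0, 0, 2], [1, 2, 1, 0, 1]⟩,
   ⟨[1], [2], [], [1], [1, 2, 0, 1, 1], [1, 2, 2, 2]⟩,
   ⟨[1], [2, 2], [], [1], [1, 2, 0, 2, 2, 1], [1, 2, 0, 1, 2]⟩,
   ⟨[1], [1, 2], [], [1], [1, 2, 1, 0, 0, 1], [1, 0, 2, 0, 2]⟩,
   ⟨[1], [1, 1], [], [1], [1, 2, 1, 1, 1, 2], [1, 0, 0, 2, 1]⟩,
   ⟨[1], [1], [], [1], [1, 2, 1, 2, 2], [1, 0, 1, 1]⟩,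
   ⟨[1], [], [], [1], [1, 2, 2], [1, 1]⟩,
   ⟨[1], [0, 2], [], [1], [1, 2, 2, 1, 1, 1], [1, 1, 1, 2, 2]⟩,
   ⟨[1], [0, 1], [], [1], [1, 2, 2, 2, 2, 2], [1, 1, 2, 1, 1]⟩,
   ⟨[2], [0, 2], [], [1], [2, 0, 0, 0, 1, 1], [1, 0, 2, 2, 2]⟩,
   ⟨[2], [0, 1], [], [1], [2, 0, 0, 1, 2, 2], [1, 0, 0, 1, 1]⟩,
   ⟨[2], [], [], [1], [2, 0, 0, 2], [1, 0, 1]⟩,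
   ⟨[2], [2], [], [1], [2, 0, 1, 0, 1], [1, 1, 0, 2]⟩,
   ⟨[2], [2, 2], [], [1], [2, 0, 1, 1, 2, 1], [1, 1, 1, 1, 2]⟩,
   ⟨[2], [2, 1], [], [1], [2, 0, 1, 2, 0, 2], [1, 1, 2, 0, 1]⟩,
   ⟨[2], [1, 1], [], [1], [2, 0, 2, 0, 1, 2], [1, 2, 1, 2, 1]⟩,
   ⟨[2], [1], [], [1], [2, 0, 2, 1, 2], [1, 2, 2, 1]⟩,
   ⟨[2], [1, 2], [], [1], [2, 0, 2, 2, 0, 1], [1, 2, 0, 0, 2]⟩,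
   ⟨[1, 0, 1], [2, 2], [2], [1, 0, 1], [1, 1, 1, 1], [1, 2, 2]⟩,
   ⟨[2, 0, 2], [1, 1], [2], [1, 0, 1], [2, 2, 1], [1, 2]⟩,
   ⟨[1, 0, 2, 1], [0, 1, 2], [0, 1], [1, 0, 1, 2], [1, 2, 2], [1, 1]⟩,
   ⟨[1, 0, 1, 2], [0, 2, 1], [0, 2], [1, 0, 2, 1], [1, 2, 2], [1, 1]⟩,
   ⟨[2, 0, 2, 0, 1], [0, 1, 2, 2], [2, 1, 1], [1, 0, 2, 2, 2], [2, 2], [1]⟩,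
   ⟨[2, 1, 1], [1], [1], [1, 1], [2, 2, 2, 1, 1], [1, 0, 2, 2]⟩,
   ⟨[1, 2, 2], [1], [2], [1, 1], [1, 0, 0, 1, 2], [1, 1, 2, 1]⟩,
   ⟨[1, 2, 0, 1], [1, 0, 2], [1, 1], [1, 1, 0, 2], [1, 2, 2], [1, 1]⟩,
   ⟨[2, 1, 2, 1, 2], [1, 0, 0, 1], [1, 0, 2], [1, 1, 1, 0, 1], [2, 2], [1]⟩,
   ⟨[1, 2, 2, 2], [1, 1, 1], [1, 2], [1, 1, 1, 1], [1, 2, 2], [1, 1]⟩,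
   ⟨[1, 2, 2], [2, 1], [2, 1], [1, 1, 1, 2], [1], [1]⟩,
   ⟨[1, 2, 1, 2, 2], [1, 0, 2, 1], [2, 1], [1, 1, 1, 2], [1], [1, 1]⟩,
   ⟨[1, 2, 0, 1, 1], [0, 2, 1, 2], [2, 1], [1, 1, 1, 2], [1], [1, 2]⟩,
   ⟨[2, 1, 1], [1, 2], [2, 1], [1, 1, 1, 2], [2], [1]⟩,
   ⟨[2, 1, 0, 2, 2], [0, 1, 2, 1], [2, 1], [1, 1, 1, 2], [2], [1, 1]⟩,
   ⟨[2, 1, 2, 1, 1], [2, 0, 1, 2], [2, 1], [1, 1, 1, 2], [2], [1, 2]⟩,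
   ⟨[1, 2, 1], [1, 2], [1], [1, 1, 2], [1, 2, 2], [1, 1]⟩,
   ⟨[2, 1, 2], [1, 2], [2], [1, 1, 2], [2, 0, 0, 2], [1, 0, 1]⟩,
   ⟨[2, 1, 2, 2], [2, 2, 1], [1, 2], [1, 1, 2, 1], [2, 2, 1], [1, 2]⟩,
   ⟨[1, 1, 1, 1], [1, 1, 2], [0, 2], [1, 2, 0, 1], [1, 0, 1], [1, 2]⟩,
   ⟨[2, 2, 2, 2], [2, 2, 1], [0, 2], [1, 2, 0, 1], [2, 2], [1]⟩,
   ⟨[1, 1, 0, 2], [2, 0, 1], [2, 2], [1, 2, 0, 1], [1, 2, 2], [1, 1]⟩,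
   ⟨[2, 2, 2, 1], [0, 0, 2], [0, 1], [1, 2, 0, 2], [2, 2, 1], [1, 2]⟩,
   ⟨[2, 2, 1], [2, 1], [1], [1, 2, 1], [2, 0, 0, 2], [1, 0, 1]⟩,
   ⟨[1, 1, 2], [2, 1], [2], [1, 2, 1], [1, 2, 2], [1, 1]⟩,
   ⟨[1, 1, 1, 2], [1, 0, 1], [2, 2], [1, 2, 1, 1], [1, 2, 1], [1, 2]⟩,
   ⟨[1, 1, 0, 0, 2], [0, 0, 1, 1], [1, 1, 2], [1, 2, 1, 2, 1], [1, 1], [1]⟩,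
   ⟨[1, 1, 1, 1], [2, 2, 2], [2, 1], [1, 2, 2, 2], [1, 2, 2], [1, 1]⟩]

/-- The coefficient lists agree with an entry of the table up to trailing zeros. -/
def InTable (x y e d : List (ZMod 3)) : Prop :=
  (table.any fun t => eqvL x t.x && eqvL y t.y && eqvL e t.e && eqvL d t.d) = true

instance decidableInTable (x y e d : List (ZMod 3)) : Decidable (InTable x y e d) :=
  inferInstanceAs (Decidable (_ = true))

instance decidableForallZModThree (p : ZMod 3 → Prop) [DecidablePred p] :
    Decidable (∀ z, p z) :=
  decidable_of_iff (p 0 ∧ p 1 ∧ p 2)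
    ⟨fun h z => by fin_cases z; exacts [h.1, h.2.1, h.2.2], fun h => ⟨h 0, h 1, h 2⟩⟩

set_option synthInstance.maxHeartbeats 400000
set_option synthInstance.maxSize 1000
set_option maxRecDepth 100000

theorem inTable_of_level_zero :
    ∀ x0 : ZMod 3, x0 ≠ 0 →
    ∀ x1 : ZMod 3, relCoeff [x0, x1] [1] [] [1] 1 = 0 →
    ∀ x2 y1 : ZMod 3, relCoeff [x0, x1, x2] [1, y1] [] [1] 2 = 0 →
    ∀ x3 y2 : ZMod 3, relCoeff [x0, x1, x2, x3] [1, y1, y2] [] [1] 3 = 0 →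
    ∀ x4 y3 : ZMod 3, relCoeff [x0, x1, x2, x3, x4] [1, y1, y2, y3] [] [1] 4 = 0 →
    ∀ x5 y4 : ZMod 3, relCoeff [x0, x1, x2, x3, x4, x5] [1, y1, y2, y3, y4] [] [1] 5 = 0 →
    relCoeff [x0, x1, x2, x3, x4, x5] [1, y1, y2, y3, y4] [] [1] 6 = 0 →
    relCoeff [x0, x1, x2, x3, x4, x5] [1, y1, y2, y3, y4] [] [1] 7 = 0 →
    relCoeff [x0, x1, x2, x3, x4, x5] [1, y1, y2, y3, y4] [] [1] 8 = 0 →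
    InTable [x0, x1, x2, x3, x4, x5] [1, y1, y2, y3, y4] [] [1] := by
  decide +kernel

theorem inTable_of_level_one :
    ∀ x0 : ZMod 3, x0 ≠ 0 →
    ∀ x1 e0 d1 : ZMod 3, relCoeff [x0, x1] [1] [e0] [1, d1] 1 = 0 →
    ∀ x2 y1 : ZMod 3, relCoeff [x0, x1, x2] [1, y1] [e0] [1, d1] 2 = 0 →
    ∀ x3 y2 : ZMod 3, relCoeff [x0, x1, x2, x3] [1, y1, y2] [e0] [1, d1] 3 = 0 →
    ∀ x4 y3 : ZMod 3, relCoeff [x0, x1, x2, x3, x4] [1, y1, y2, y3] [e0] [1, d1] 4 = 0 →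
    relCoeff [x0, x1, x2, x3, x4] [1, y1, y2, y3] [e0] [1, d1] 5 = 0 →
    relCoeff [x0, x1, x2, x3, x4] [1, y1, y2, y3] [e0] [1, d1] 6 = 0 →
    relCoeff [x0, x1, x2, x3, x4] [1, y1, y2, y3] [e0] [1, d1] 7 = 0 →
    relCoeff [x0, x1, x2, x3, x4] [1, y1, y2, y3] [e0] [1, d1] 8 = 0 →
    InTable [x0, x1, x2, x3, x4] [1, y1, y2, y3] [e0] [1, d1] := by
  decide +kernel

theorem inTable_of_level_two :
    ∀ x0 : ZMod 3, x0 ≠ 0 →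
    ∀ x1 e0 d1 : ZMod 3, relCoeff [x0, x1] [1] [e0] [1, d1] 1 = 0 →
    ∀ x2 y1 e1 d2 : ZMod 3, relCoeff [x0, x1, x2] [1, y1] [e0, e1] [1, d1, d2] 2 = 0 →
    ∀ x3 y2 : ZMod 3, relCoeff [x0, x1, x2, x3] [1, y1, y2] [e0, e1] [1, d1, d2] 3 = 0 →
    relCoeff [x0, x1, x2, x3] [1, y1, y2] [e0, e1] [1, d1, d2] 4 = 0 →
    relCoeff [x0, x1, x2, x3] [1, y1, y2] [e0, e1] [1, d1, d2] 5 = 0 →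
    relCoeff [x0, x1, x2, x3] [1, y1, y2] [e0, e1] [1, d1, d2] 6 = 0 →
    relCoeff [x0, x1, x2, x3] [1, y1, y2] [e0, e1] [1, d1, d2] 7 = 0 →
    relCoeff [x0, x1, x2, x3] [1, y1, y2] [e0, e1] [1, d1, d2] 8 = 0 →
    InTable [x0, x1, x2, x3] [1, y1, y2] [e0, e1] [1, d1, d2] := by
  decide +kernel

theorem inTable_of_level_three :
    ∀ x0 : ZMod 3, x0 ≠ 0 →
    ∀ x1 e0 d1 : ZMod 3, relCoeff [x0, x1] [1] [e0] [1, d1] 1 = 0 →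
    ∀ x2 y1 e1 d2 : ZMod 3, relCoeff [x0, x1, x2] [1, y1] [e0, e1] [1, d1, d2] 2 = 0 →
    ∀ e2 d3 : ZMod 3, relCoeff [x0, x1, x2] [1, y1] [e0, e1, e2] [1, d1, d2, d3] 3 = 0 →
    relCoeff [x0, x1, x2] [1, y1] [e0, e1, e2] [1, d1, d2, d3] 4 = 0 →
    relCoeff [x0, x1, x2] [1, y1] [e0, e1, e2] [1, d1, d2, d3] 5 = 0 →
    relCoeff [x0, x1, x2] [1, y1] [e0, e1, e2] [1, d1, d2, d3] 6 = 0 →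
    relCoeff [x0, x1, x2] [1, y1] [e0, e1, e2] [1, d1, d2, d3] 7 = 0 →
    relCoeff [x0, x1, x2] [1, y1] [e0, e1, e2] [1, d1, d2, d3] 8 = 0 →
    InTable [x0, x1, x2] [1, y1] [e0, e1, e2] [1, d1, d2, d3] := by
  decide +kernel

theorem inTable_of_level_four :
    ∀ x0 : ZMod 3, x0 ≠ 0 →
    ∀ x1 e0 d1 : ZMod 3, relCoeff [x0, x1] [1] [e0] [1, d1] 1 = 0 →
    ∀ e1 d2 : ZMod 3, relCoeff [x0, x1] [1] [e0, e1] [1, d1, d2] 2 = 0 →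
    ∀ e2 d3 : ZMod 3, relCoeff [x0, x1] [1] [e0, e1, e2] [1, d1, d2, d3] 3 = 0 →
    ∀ e3 d4 : ZMod 3, relCoeff [x0, x1] [1] [e0, e1, e2, e3] [1, d1, d2, d3, d4] 4 = 0 →
    relCoeff [x0, x1] [1] [e0, e1, e2, e3] [1, d1, d2, d3, d4] 5 = 0 →
    relCoeff [x0, x1] [1] [e0, e1, e2, e3] [1, d1, d2, d3, d4] 6 = 0 →
    relCoeff [x0, x1] [1] [e0, e1, e2, e3] [1, d1, d2, d3, d4] 7 = 0 →
    relCoeff [x0, x1] [1] [e0, e1, e2, e3] [1, d1, d2, d3, d4] 8 = 0 →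
    InTable [x0, x1] [1] [e0, e1, e2, e3] [1, d1, d2, d3, d4] := by
  decide +kernel

end Search

section Rows

variable {K : Type*} [NormedField K] {φ : (ZMod 3)[X] →+* K} {ρ : K}

/-- The value `T² (x ω + y)` at `ω = T⁻² ρ` of the linear form with coefficient row `(x, y)`. -/
noncomputable def rowVal (φ : (ZMod 3)[X] →+* K) (ρ : K) (x y : (ZMod 3)[X]) : K :=
  φ x * ρ + φ X ^ 2 * φ y

/-- First entry of the row `(x, y) α`. -/
noncomputable def alphaFst (x y : (ZMod 3)[X]) : (ZMod 3)[X] :=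
  x * (X ^ 3 + 2 * X ^ 2 + 2 * X + 2) + y * (X ^ 4 + X ^ 3 + X ^ 2)

/-- Second entry of the row `(x, y) α`. -/
noncomputable def alphaSnd (x y : (ZMod 3)[X]) : (ZMod 3)[X] :=
  x * (2 * X + 1) + y * (2 * X ^ 2 + 2 * X + 1)

theorem three_eq_zero : (3 : (ZMod 3)[X]) = 0 := by
  have h : (3 : ZMod 3) = 0 := by decide
  rw [← Polynomial.C_ofNat, h, Polynomial.C_0]

theorem coeff_zero_alphaSnd {x y : (ZMod 3)[X]} (hx : x.coeff 0 = 0) :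
    (alphaSnd x y).coeff 0 = y.coeff 0 := by
  simp [alphaSnd, Polynomial.mul_coeff_zero, hx]

theorem rowVal_alpha (x y : (ZMod 3)[X]) :
    rowVal φ ρ (alphaFst x y) (alphaSnd x y)
      = φ x * rowVal φ ρ (alphaFst 1 0) (alphaSnd 1 0)
        + φ y * rowVal φ ρ (alphaFst 0 1) (alphaSnd 0 1) := by
  simp only [rowVal, alphaFst, alphaSnd, map_add, map_mul, map_one, map_zero, map_pow]
  ring

theorem rowVal_eq (x y : (ZMod 3)[X]) : rowVal φ ρ x y = φ x * ρ + φ (X ^ 2 * y) := by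
  rw [rowVal, map_mul, map_pow]

variable [IsUltrametricDist K] (hφ : ‖φ X‖ = 3) (hρ : ρ ^ 2 + 1 = 0)

include hφ hρ

theorem norm_rowVal {x y : (ZMod 3)[X]} (hy : y ≠ 0) :
    ‖rowVal φ ρ x y‖ = 3 ^ max x.natDegree (y.natDegree + 2) := by
  rw [rowVal_eq, norm_map_mul_add hφ hρ (by simpa using hy),
    Polynomial.natDegree_X_pow_mul 2 hy]

theorem norm_rowVal_le {x y : (ZMod 3)[X]} {n : ℕ} (hx : x.natDegree ≤ n)
    (hy : (X ^ 2 * y).natDegree ≤ n) : ‖rowVal φ ρ x y‖ ≤ 3 ^ n := by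
  rw [rowVal_eq]
  refine (IsUltrametricDist.norm_add_le_max _ _).trans (max_le ?_ (norm_map_le hφ hy))
  rw [norm_mul, norm_sqrt_neg_one hρ, mul_one]
  exact norm_map_le hφ hx

theorem rowVal_ne_zero {x y : (ZMod 3)[X]} (hy : y.coeff 0 ≠ 0) : rowVal φ ρ x y ≠ 0 := by
  rw [← norm_pos_iff, norm_rowVal hφ hρ (by rintro rfl; simp at hy)]
  positivity

theorem norm_cross_le {c d c' d' : (ZMod 3)[X]} {u : ZMod 3}
    (hdet : c' * d - d' * c = X * Polynomial.C u) :
    ‖rowVal φ ρ c' d' * rowVal φ ρ (alphaFst c d) (alphaSnd c d)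
      - rowVal φ ρ c d * rowVal φ ρ (alphaFst c' d') (alphaSnd c' d')‖ ≤ 3 ^ 6 := by
  have e : rowVal φ ρ c' d' * rowVal φ ρ (alphaFst c d) (alphaSnd c d)
      - rowVal φ ρ c d * rowVal φ ρ (alphaFst c' d') (alphaSnd c' d')
      = φ (X * Polynomial.C u) * (ρ * rowVal φ ρ (alphaFst 0 1) (alphaSnd 0 1)
        - φ (X ^ 2) * rowVal φ ρ (alphaFst 1 0) (alphaSnd 1 0)) := by
    rw [rowVal_alpha c d, rowVal_alpha c' d', ← hdet, map_sub, map_mul, map_mul, map_pow]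
    simp only [rowVal]
    ring
  have h1 : ‖rowVal φ ρ (alphaFst 0 1) (alphaSnd 0 1)‖ ≤ 3 ^ 4 := by
    apply norm_rowVal_le hφ hρ
    · simp only [alphaFst, one_mul, zero_mul, zero_add]; compute_degree
    · simp only [alphaSnd, one_mul, zero_mul, zero_add]; compute_degree
  have h2 : ‖rowVal φ ρ (alphaFst 1 0) (alphaSnd 1 0)‖ ≤ 3 ^ 3 := by
    apply norm_rowVal_le hφ hρ
    · simp only [alphaFst, one_mul, zero_mul, add_zero]; compute_degree
    · simp only [alphaSnd, one_mul, zero_mul, add_zero]; compute_degree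
  have h3 : ‖ρ * rowVal φ ρ (alphaFst 0 1) (alphaSnd 0 1)
        - φ (X ^ 2) * rowVal φ ρ (alphaFst 1 0) (alphaSnd 1 0)‖ ≤ 3 ^ 5 := by
    rw [sub_eq_add_neg]
    refine (IsUltrametricDist.norm_add_le_max _ _).trans (max_le ?_ ?_)
    · rw [norm_mul, norm_sqrt_neg_one hρ, one_mul]
      exact h1.trans (by norm_num)
    · rw [norm_neg, norm_mul, map_pow, norm_pow, hφ]
      linarith
  rw [e, norm_mul, map_mul, norm_mul, hφ]
  have := norm_map_C_le (φ := φ) u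
  calc 3 * ‖φ (Polynomial.C u)‖ * _ ≤ 3 * 1 * (3 : ℝ) ^ 5 := by gcongr
    _ = 3 ^ 6 := by norm_num

end Rows

section Matrices

/-- First entry of the row `(-X, 1) γ`. -/
noncomputable def cuspFst (g : Matrix (Fin 2) (Fin 2) (ZMod 3)[X]) : (ZMod 3)[X] :=
  g 1 0 - X * g 0 0

/-- Second entry of the row `(-X, 1) γ`. -/
noncomputable def cuspSnd (g : Matrix (Fin 2) (Fin 2) (ZMod 3)[X]) : (ZMod 3)[X] :=
  g 1 1 - X * g 0 1

theorem coeff_zero_lower_left {g : Matrix (Fin 2) (Fin 2) (ZMod 3)[X]} (hg : g ∈ Gamma0TTT) :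
    (g 1 0).coeff 0 = 0 := by
  obtain ⟨e, he⟩ := hg.2
  rw [he, Polynomial.mul_coeff_zero]
  simp

theorem coeff_zero_lower_right {g : Matrix (Fin 2) (Fin 2) (ZMod 3)[X]} (hg : g ∈ Gamma0TTT) :
    (g 1 1).coeff 0 ≠ 0 := by
  obtain ⟨u, hu, hdet⟩ := hg.1
  rw [Matrix.det_fin_two] at hdet
  have h := congrArg (fun p => Polynomial.coeff p 0) hdet
  simp only [Polynomial.coeff_sub, Polynomial.mul_coeff_zero, coeff_zero_lower_left hg, mul_zero,
    sub_zero, Polynomial.coeff_C_zero] at h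
  intro h0
  rw [h0, mul_zero] at h
  exact hu h.symm

theorem coeff_zero_cuspFst {g : Matrix (Fin 2) (Fin 2) (ZMod 3)[X]} (hg : g ∈ Gamma0TTT) :
    (cuspFst g).coeff 0 = 0 := by
  simp [cuspFst, coeff_zero_lower_left hg]

theorem coeff_zero_cuspSnd (g : Matrix (Fin 2) (Fin 2) (ZMod 3)[X]) :
    (cuspSnd g).coeff 0 = (g 1 1).coeff 0 := by
  simp [cuspSnd]

theorem cusp_det {g : Matrix (Fin 2) (Fin 2) (ZMod 3)[X]} (hg : g ∈ Gamma0TTT) :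
    ∃ u : ZMod 3, u ≠ 0 ∧ cuspFst g * g 1 1 - cuspSnd g * g 1 0 = X * Polynomial.C u := by
  obtain ⟨u, hu, hdet⟩ := hg.1
  rw [Matrix.det_fin_two] at hdet
  refine ⟨-u, neg_ne_zero.2 hu, ?_⟩
  rw [Polynomial.C_neg, ← hdet, cuspFst, cuspSnd]
  ring

/-- A matrix is determined by the rows `(0, 1) γ` and `(-X, 1) γ α`. -/
theorem eq_of_rows {g h : Matrix (Fin 2) (Fin 2) (ZMod 3)[X]} (hc : g 1 0 = h 1 0)
    (hd : g 1 1 = h 1 1)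
    (hx : alphaFst (cuspFst g) (cuspSnd g) = alphaFst (cuspFst h) (cuspSnd h))
    (hy : alphaSnd (cuspFst g) (cuspSnd g) = alphaSnd (cuspFst h) (cuspSnd h)) : g = h := by
  simp only [alphaFst, alphaSnd, cuspFst, cuspSnd, hc, hd] at hx hy
  have ha : X * g 0 0 = X * h 0 0 := by
    linear_combination (2 * X ^ 2 + 2 * X + 1) * hx - (X ^ 4 + X ^ 3 + X ^ 2) * hy
      + X * (g 0 0 - h 0 0) * (1 + 2 * X + 3 * X ^ 2 + 2 * X ^ 3 + X ^ 4) * three_eq_zero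
  have hb : X * g 0 1 = X * h 0 1 := by
    linear_combination (X ^ 3 + 2 * X ^ 2 + 2 * X + 2) * hy - (2 * X + 1) * hx
      + X * (g 0 1 - h 0 1) * (1 + 2 * X + 3 * X ^ 2 + 2 * X ^ 3 + X ^ 4) * three_eq_zero
  have ha' := mul_left_cancel₀ Polynomial.X_ne_zero ha
  have hb' := mul_left_cancel₀ Polynomial.X_ne_zero hb
  refine Matrix.ext fun i j => ?_
  fin_cases i <;> fin_cases j
  exacts [ha', hb', hc, hd]

end Matrices

section Factor

variable {K : Type*} [NormedField K] {φ : (ZMod 3)[X] →+* K} {ρ : K}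

/-- The height of a row `(x, y)`: the norm of `rowVal φ ρ x y` is `3 ^ rowHeight x y`. -/
noncomputable def rowHeight (x y : (ZMod 3)[X]) : ℕ := max x.natDegree (y.natDegree + 2)

/-- The height of the row `(-X, 1) γ α`. -/
noncomputable def cuspHeight (g : Matrix (Fin 2) (Fin 2) (ZMod 3)[X]) : ℕ :=
  rowHeight (alphaFst (cuspFst g) (cuspSnd g)) (alphaSnd (cuspFst g) (cuspSnd g))

/-- The numerator of the factor of `u_α(1/T)` at `γ`. -/
noncomputable def factorNum (φ : (ZMod 3)[X] →+* K) (ρ : K)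
    (g : Matrix (Fin 2) (Fin 2) (ZMod 3)[X]) : K :=
  rowVal φ ρ (cuspFst g) (cuspSnd g)
    * rowVal φ ρ (alphaFst (g 1 0) (g 1 1)) (alphaSnd (g 1 0) (g 1 1))

/-- The denominator of the factor of `u_α(1/T)` at `γ`. -/
noncomputable def factorDen (φ : (ZMod 3)[X] →+* K) (ρ : K)
    (g : Matrix (Fin 2) (Fin 2) (ZMod 3)[X]) : K :=
  rowVal φ ρ (g 1 0) (g 1 1)
    * rowVal φ ρ (alphaFst (cuspFst g) (cuspSnd g)) (alphaSnd (cuspFst g) (cuspSnd g))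

theorem rowVal_cusp (g : Matrix (Fin 2) (Fin 2) (ZMod 3)[X]) :
    rowVal φ ρ (cuspFst g) (cuspSnd g)
      = rowVal φ ρ (g 1 0) (g 1 1) - φ X * rowVal φ ρ (g 0 0) (g 0 1) := by
  simp only [rowVal, cuspFst, cuspSnd, map_sub, map_mul]
  ring

theorem rowVal_alpha_cusp (g : Matrix (Fin 2) (Fin 2) (ZMod 3)[X]) :
    rowVal φ ρ (alphaFst (cuspFst g) (cuspSnd g)) (alphaSnd (cuspFst g) (cuspSnd g))
      = rowVal φ ρ (alphaFst (g 1 0) (g 1 1)) (alphaSnd (g 1 0) (g 1 1))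
        - φ X * rowVal φ ρ (alphaFst (g 0 0) (g 0 1)) (alphaSnd (g 0 0) (g 0 1)) := by
  simp only [rowVal, alphaFst, alphaSnd, cuspFst, cuspSnd, map_sub, map_mul, map_add]
  ring

theorem moebius_eq_rowVal_div (ht : φ X ≠ 0) (a b c d : (ZMod 3)[X]) :
    (φ a * ((φ X)⁻¹ ^ 2 * ρ) + φ b) / (φ c * ((φ X)⁻¹ ^ 2 * ρ) + φ d)
      = rowVal φ ρ a b / rowVal φ ρ c d := by
  have h (x y : (ZMod 3)[X]) :
      rowVal φ ρ x y = φ X ^ 2 * (φ x * ((φ X)⁻¹ ^ 2 * ρ) + φ y) := by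
    rw [rowVal]; field_simp
  rw [h, h, mul_div_mul_left _ _ (pow_ne_zero 2 ht)]

theorem coeff_zero_alphaSnd_cusp {g : Matrix (Fin 2) (Fin 2) (ZMod 3)[X]} (hg : g ∈ Gamma0TTT) :
    (alphaSnd (cuspFst g) (cuspSnd g)).coeff 0 = (g 1 1).coeff 0 := by
  rw [coeff_zero_alphaSnd (coeff_zero_cuspFst hg), coeff_zero_cuspSnd]

variable [IsUltrametricDist K] (hφ : ‖φ X‖ = 3) (hρ : ρ ^ 2 + 1 = 0)

include hφ

omit [IsUltrametricDist K] in
theorem map_X_ne_zero : φ X ≠ 0 := by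
  rw [← norm_ne_zero_iff, hφ]; norm_num

include hρ

variable {g : Matrix (Fin 2) (Fin 2) (ZMod 3)[X]} (hg : g ∈ Gamma0TTT)

include hg

theorem rowVal_lower_ne_zero : rowVal φ ρ (g 1 0) (g 1 1) ≠ 0 :=
  rowVal_ne_zero hφ hρ (coeff_zero_lower_right hg)

theorem rowVal_alpha_lower_ne_zero :
    rowVal φ ρ (alphaFst (g 1 0) (g 1 1)) (alphaSnd (g 1 0) (g 1 1)) ≠ 0 :=
  rowVal_ne_zero hφ hρ
    (by rw [coeff_zero_alphaSnd (coeff_zero_lower_left hg)]; exact coeff_zero_lower_right hg)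

theorem rowVal_alpha_cusp_ne_zero :
    rowVal φ ρ (alphaFst (cuspFst g) (cuspSnd g)) (alphaSnd (cuspFst g) (cuspSnd g)) ≠ 0 :=
  rowVal_ne_zero hφ hρ
    (by rw [coeff_zero_alphaSnd_cusp hg]; exact coeff_zero_lower_right hg)

theorem factor_eq {z : K}
    (hz : z = rowVal φ ρ (alphaFst 1 0) (alphaSnd 1 0) / rowVal φ ρ (alphaFst 0 1) (alphaSnd 0 1)) :
    ((φ X)⁻¹ - (φ (g 0 0) * ((φ X)⁻¹ ^ 2 * ρ) + φ (g 0 1))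
        / (φ (g 1 0) * ((φ X)⁻¹ ^ 2 * ρ) + φ (g 1 1)))
      / ((φ X)⁻¹ - (φ (g 0 0) * z + φ (g 0 1)) / (φ (g 1 0) * z + φ (g 1 1)))
      = factorNum φ ρ g / factorDen φ ρ g := by
  have ht := map_X_ne_zero hφ
  have hD := rowVal_lower_ne_zero hφ hρ hg
  have hDα := rowVal_alpha_lower_ne_zero hφ hρ hg
  have hQ : rowVal φ ρ (alphaFst 0 1) (alphaSnd 0 1) ≠ 0 :=
    rowVal_ne_zero hφ hρ (by rw [coeff_zero_alphaSnd (by simp)]; simp)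
  have hact (x y : (ZMod 3)[X]) : φ x * z + φ y
      = rowVal φ ρ (alphaFst x y) (alphaSnd x y) / rowVal φ ρ (alphaFst 0 1) (alphaSnd 0 1) := by
    rw [rowVal_alpha x y, hz]; field_simp
  rw [moebius_eq_rowVal_div ht, hact, hact, div_div_div_cancel_right₀ hQ, factorNum, factorDen]
  have hsub {N D : K} (hD : D ≠ 0) : (φ X)⁻¹ - N / D = (D - φ X * N) / (φ X * D) := by
    field_simp
  rw [hsub hD, hsub hDα, ← rowVal_cusp, ← rowVal_alpha_cusp]
  have := rowVal_alpha_cusp_ne_zero hφ hρ hg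
  field_simp

theorem factorDen_ne_zero : factorDen φ ρ g ≠ 0 :=
  mul_ne_zero (rowVal_lower_ne_zero hφ hρ hg) (rowVal_alpha_cusp_ne_zero hφ hρ hg)

theorem norm_factorDen : ‖factorDen φ ρ g‖ = 3 ^ (rowHeight (g 1 0) (g 1 1) + cuspHeight g) := by
  have h0 := coeff_zero_lower_right hg
  rw [factorDen, norm_mul, norm_rowVal hφ hρ, norm_rowVal hφ hρ, pow_add]
  · rfl
  · intro h
    rw [← coeff_zero_alphaSnd_cusp hg, h] at h0
    exact h0 rfl
  · intro h
    rw [h] at h0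
    exact h0 rfl

theorem norm_factor_sub_one_le :
    ‖factorNum φ ρ g / factorDen φ ρ g - 1‖
      ≤ 3 ^ 6 / 3 ^ (rowHeight (g 1 0) (g 1 1) + cuspHeight g) := by
  obtain ⟨u, -, hdet⟩ := cusp_det hg
  rw [div_sub_one (factorDen_ne_zero hφ hρ hg), norm_div, norm_factorDen hφ hρ hg]
  gcongr
  exact norm_cross_le hφ hρ hdet

theorem height_le_of_lt_norm {n : ℕ}
    (h : 3 ^ 6 < ‖factorNum φ ρ g / factorDen φ ρ g - 1‖ * 3 ^ (n + 1)) :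
    rowHeight (g 1 0) (g 1 1) + cuspHeight g ≤ n := by
  by_contra! hlt
  have h1 := norm_factor_sub_one_le hφ hρ hg
  rw [le_div_iff₀ (by positivity)] at h1
  have h2 : (3 : ℝ) ^ (n + 1) ≤ 3 ^ (rowHeight (g 1 0) (g 1 1) + cuspHeight g) :=
    pow_le_pow_right₀ (by norm_num) hlt
  have h3 := mul_le_mul_of_nonneg_left h2 (norm_nonneg (factorNum φ ρ g / factorDen φ ρ g - 1))
  linarith

end Factor

section Finiteness

theorem finite_natDegree_le (n : ℕ) : {p : (ZMod 3)[X] | p.natDegree ≤ n}.Finite := by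
  refine (Set.finite_range fun c : Fin (n + 1) → ZMod 3 =>
    ∑ i, Polynomial.C (c i) * X ^ (i : ℕ)).subset fun p hp => ⟨fun i => p.coeff i, ?_⟩
  have h := p.as_sum_range_C_mul_X_pow' (Nat.lt_succ_of_le hp)
  rw [← Fin.sum_univ_eq_sum_range (fun i => Polynomial.C (p.coeff i) * X ^ i)] at h
  exact h.symm

theorem finite_height_le (n : ℕ) :
    {g : Matrix (Fin 2) (Fin 2) (ZMod 3)[X] |
      rowHeight (g 1 0) (g 1 1) + cuspHeight g ≤ n}.Finite := by
  have hfin := finite_natDegree_le n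
  refine Set.Finite.of_finite_image (f := fun g => (g 1 0, g 1 1,
    alphaFst (cuspFst g) (cuspSnd g), alphaSnd (cuspFst g) (cuspSnd g)))
    ((hfin.prod (hfin.prod (hfin.prod hfin))).subset ?_) ?_
  · rintro _ ⟨g, hg, rfl⟩
    simp only [Set.mem_ofPred_eq, rowHeight, cuspHeight] at hg
    simp only [Set.mem_prod, Set.mem_ofPred_eq]
    omega
  · rintro g - h - hgh
    simp only [Prod.mk.injEq] at hgh
    exact eq_of_rows hgh.1 hgh.2.1 hgh.2.2.1 hgh.2.2.2

end Finiteness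

section Classification

theorem coeff_determinant_relation {c c' d' d e x y : (ZMod 3)[X]} {u : ZMod 3}
    (hc : c = (X ^ 3 - X ^ 2) * e) (hx : alphaFst c' d' = X * x) (hy : alphaSnd c' d' = y)
    (hdet : c' * d - d' * c = X * Polynomial.C u) :
    x * (d * (1 - X - X ^ 2) - e * (X ^ 2 + X ^ 3 + X ^ 4))
      - y * (d * (X + X ^ 2 + X ^ 3) + e * (X + X ^ 4 + X ^ 5)) = Polynomial.C (-u) := by
  apply mul_left_cancel₀ (Polynomial.X_ne_zero (R := ZMod 3))
  subst hc
  rw [alphaFst] at hx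
  rw [alphaSnd] at hy
  rw [Polynomial.C_neg]
  linear_combination -(d * (1 - X - X ^ 2) - e * (X ^ 2 + X ^ 3 + X ^ 4)) * hx
    + X * (d * (X + X ^ 2 + X ^ 3) + e * (X + X ^ 4 + X ^ 5)) * hy - hdet
    + ((c' * d - d' * ((X ^ 3 - X ^ 2) * e)) * (1 + 2 * X + 3 * X ^ 2 + 2 * X ^ 3 + X ^ 4)
      - (c' * (X ^ 3 + 2 * X ^ 2 + 2 * X + 2) + d' * (X ^ 4 + X ^ 3 + X ^ 2))
        * (d * (X ^ 2 + X) + X ^ 4 * e)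
      - (c' * (2 * X + 1) + d' * (2 * X ^ 2 + 2 * X + 1)) * (X ^ 2 * e)) * three_eq_zero

theorem InTable.exists_mem {lx ly le ld : List (ZMod 3)} (h : InTable lx ly le ld) :
    ∃ t ∈ table, ofL lx = ofL t.x ∧ ofL ly = ofL t.y ∧ ofL le = ofL t.e ∧ ofL ld = ofL t.d := by
  simp only [InTable, List.any_eq_true, Bool.and_eq_true] at h
  obtain ⟨t, ht, ⟨⟨hx, hy⟩, he⟩, hd⟩ := h
  exact ⟨t, ht, ofL_eq_of_eqvL hx, ofL_eq_of_eqvL hy, ofL_eq_of_eqvL he, ofL_eq_of_eqvL hd⟩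

theorem inTable_of_relation {x y e d : (ZMod 3)[X]} {m : ℕ} (hm : m ≤ 4)
    (hx : ∀ i, 6 - m ≤ i → x.coeff i = 0) (hy : ∀ i, 5 - m ≤ i → y.coeff i = 0)
    (he : ∀ i, m ≤ i → e.coeff i = 0) (hd : ∀ i, m + 1 ≤ i → d.coeff i = 0)
    (hx0 : x.coeff 0 ≠ 0) (hy0 : y.coeff 0 = 1) (hd0 : d.coeff 0 = 1)
    {u : ZMod 3} (hrel : x * (d * (1 - X - X ^ 2) - e * (X ^ 2 + X ^ 3 + X ^ 4))
      - y * (d * (X + X ^ 2 + X ^ 3) + e * (X + X ^ 4 + X ^ 5)) = Polynomial.C u) :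
    InTable ((List.range (6 - m)).map x.coeff) ((List.range (5 - m)).map y.coeff)
      ((List.range m).map e.coeff) ((List.range (m + 1)).map d.coeff) := by
  have r : ∀ k, relCoeff ((List.range (6 - m)).map x.coeff) ((List.range (5 - m)).map y.coeff)
      ((List.range m).map e.coeff) ((List.range (m + 1)).map d.coeff) (k + 1) = 0 := fun k => by
    rw [← coeff_relation, ofL_map_coeff hx, ofL_map_coeff hy, ofL_map_coeff he, ofL_map_coeff hd,
      hrel, Polynomial.coeff_C_succ]
  clear hrel hx hy he hd
  interval_cases m
  · simp only [List.range, List.range.loop, List.map, hy0, hd0] at r ⊢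
    exact inTable_of_level_zero _ hx0 (x.coeff 1) (r 0) (x.coeff 2) (y.coeff 1) (r 1) (x.coeff 3)
      (y.coeff 2) (r 2) (x.coeff 4) (y.coeff 3) (r 3) (x.coeff 5) (y.coeff 4) (r 4) (r 5) (r 6)
      (r 7)
  · simp only [List.range, List.range.loop, List.map, hy0, hd0] at r ⊢
    exact inTable_of_level_one _ hx0 (x.coeff 1) (e.coeff 0) (d.coeff 1) (r 0) (x.coeff 2)
      (y.coeff 1) (r 1) (x.coeff 3) (y.coeff 2) (r 2) (x.coeff 4) (y.coeff 3) (r 3) (r 4) (r 5)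
      (r 6) (r 7)
  · simp only [List.range, List.range.loop, List.map, hy0, hd0] at r ⊢
    exact inTable_of_level_two _ hx0 (x.coeff 1) (e.coeff 0) (d.coeff 1) (r 0) (x.coeff 2)
      (y.coeff 1) (e.coeff 1) (d.coeff 2) (r 1) (x.coeff 3) (y.coeff 2) (r 2) (r 3) (r 4) (r 5)
      (r 6) (r 7)
  · simp only [List.range, List.range.loop, List.map, hy0, hd0] at r ⊢
    exact inTable_of_level_three _ hx0 (x.coeff 1) (e.coeff 0) (d.coeff 1) (r 0) (x.coeff 2)
      (y.coeff 1) (e.coeff 1) (d.coeff 2) (r 1) (e.coeff 2) (d.coeff 3) (r 2) (r 3) (r 4) (r 5)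
      (r 6) (r 7)
  · simp only [List.range, List.range.loop, List.map, hy0, hd0] at r ⊢
    exact inTable_of_level_four _ hx0 (x.coeff 1) (e.coeff 0) (d.coeff 1) (r 0) (e.coeff 1)
      (d.coeff 2) (r 1) (e.coeff 2) (d.coeff 3) (r 2) (e.coeff 3) (d.coeff 4) (r 3) (r 4) (r 5)
      (r 6) (r 7)

theorem exists_mem_table {g : Matrix (Fin 2) (Fin 2) (ZMod 3)[X]} (hg : g ∈ Gamma0TTT)
    (hd0 : (g 1 1).coeff 0 = 1) (hh : rowHeight (g 1 0) (g 1 1) + cuspHeight g ≤ 8) :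
    ∃ t ∈ table, g 1 0 = (X ^ 3 - X ^ 2) * ofL t.e ∧ g 1 1 = ofL t.d ∧
      alphaFst (cuspFst g) (cuspSnd g) = X * ofL t.x ∧
      alphaSnd (cuspFst g) (cuspSnd g) = ofL t.y := by
  obtain ⟨e, he⟩ := hg.2
  obtain ⟨u, hu, hdet⟩ := cusp_det hg
  obtain ⟨x, hx⟩ : X ∣ alphaFst (cuspFst g) (cuspSnd g) := by
    rw [Polynomial.X_dvd_iff]
    simp [alphaFst, Polynomial.mul_coeff_zero, coeff_zero_cuspFst hg]
  obtain ⟨y, hy⟩ : ∃ y, alphaSnd (cuspFst g) (cuspSnd g) = y := ⟨_, rfl⟩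
  have hy0 : y.coeff 0 = 1 := by
    rw [← hy, coeff_zero_alphaSnd (coeff_zero_cuspFst hg), coeff_zero_cuspSnd, hd0]
  have hrel := coeff_determinant_relation he hx hy hdet
  have hx0 : x.coeff 0 ≠ 0 := by
    have h := congrArg (fun p => Polynomial.coeff p 0) hrel
    simp [Polynomial.mul_coeff_zero, hd0] at h
    rw [h]
    exact neg_ne_zero.2 hu
  have hxne : x ≠ 0 := by rintro rfl; exact hx0 rfl
  have hmonic : (X ^ 3 - X ^ 2 : (ZMod 3)[X]).Monic := by monicity!
  have hdeg3 : (X ^ 3 - X ^ 2 : (ZMod 3)[X]).natDegree = 3 := by compute_degree!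
  have hedeg : e = 0 ∨ (g 1 0).natDegree = 3 + e.natDegree := by
    rcases eq_or_ne e 0 with h | h
    · exact Or.inl h
    · right
      rw [he, hmonic.natDegree_mul' h, hdeg3]
  simp only [rowHeight, cuspHeight, hx, hy, Polynomial.natDegree_X_mul hxne] at hh
  set m := max (g 1 0).natDegree ((g 1 1).natDegree + 2) - 2 with hm
  have hvx : ∀ i, 6 - m ≤ i → x.coeff i = 0 := fun i hi =>
    Polynomial.coeff_eq_zero_of_natDegree_lt (by omega)
  have hvy : ∀ i, 5 - m ≤ i → y.coeff i = 0 := fun i hi =>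
    Polynomial.coeff_eq_zero_of_natDegree_lt (by omega)
  have hvd : ∀ i, m + 1 ≤ i → (g 1 1).coeff i = 0 := fun i hi =>
    Polynomial.coeff_eq_zero_of_natDegree_lt (by omega)
  have hve : ∀ i, m ≤ i → e.coeff i = 0 := fun i hi => by
    rcases hedeg with rfl | h
    · simp
    · exact Polynomial.coeff_eq_zero_of_natDegree_lt (by omega)
  obtain ⟨t, ht, htx, hty, hte, htd⟩ :=
    (inTable_of_relation (by omega) hvx hvy hve hvd hx0 hy0 hd0 hrel).exists_mem
  rw [ofL_map_coeff hvx] at htx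
  rw [ofL_map_coeff hvy] at hty
  rw [ofL_map_coeff hve] at hte
  rw [ofL_map_coeff hvd] at htd
  exact ⟨t, ht, by rw [he, hte], htd, by rw [hx, htx], by rw [hy, hty]⟩

end Classification

section TableMatrices

/-- The coefficients of `alphaFst`. -/
def alphaFstL (x y : List (ZMod 3)) : List (ZMod 3) :=
  addL (mulL x [2, 2, 2, 1]) (mulL y [0, 0, 1, 1, 1])

/-- The coefficients of `alphaSnd`. -/
def alphaSndL (x y : List (ZMod 3)) : List (ZMod 3) := addL (mulL x [1, 2]) (mulL y [1, 2, 2])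

theorem C_two : Polynomial.C (2 : ZMod 3) = 2 := Polynomial.C_ofNat 2

theorem ofL_alphaFstL (x y : List (ZMod 3)) : ofL (alphaFstL x y) = alphaFst (ofL x) (ofL y) := by
  simp only [alphaFstL, alphaFst, ofL_addL, ofL_mulL, ofL_cons, ofL_nil, C_two, Polynomial.C_0,
    Polynomial.C_1]
  ring

theorem ofL_alphaSndL (x y : List (ZMod 3)) : ofL (alphaSndL x y) = alphaSnd (ofL x) (ofL y) := by
  simp only [alphaSndL, alphaSnd, ofL_addL, ofL_mulL, ofL_cons, ofL_nil, C_two, Polynomial.C_1]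
  ring

namespace Entry

/-- The matrix in `Γ` described by an entry of the table. -/
noncomputable def mat (t : Entry) : Matrix (Fin 2) (Fin 2) (ZMod 3)[X] :=
  !![ofL t.a, ofL t.b; (X ^ 3 - X ^ 2) * ofL t.e, ofL t.d]

/-- The coefficients of the lower left entry of the matrix. -/
def c (t : Entry) : List (ZMod 3) := mulL [0, 0, 2, 1] t.e

/-- The coefficients of `cuspFst`. -/
def p (t : Entry) : List (ZMod 3) := addL t.c (scaleL 2 (0 :: t.a))

/-- The coefficients of `cuspSnd`. -/
def q (t : Entry) : List (ZMod 3) := addL t.d (scaleL 2 (0 :: t.b))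

/-- The coefficients of the determinant. -/
def det (t : Entry) : List (ZMod 3) := addL (mulL t.a t.d) (scaleL 2 (mulL t.b t.c))

/-- The matrix lies in `Γ`, with the row `(X x, y)` as described. -/
def IsValid (t : Entry) : Prop :=
  (eqvL t.det [1] || eqvL t.det [2]) = true ∧ eqvL (alphaFstL t.p t.q) (0 :: t.x) = true ∧
    eqvL (alphaSndL t.p t.q) t.y = true

instance (t : Entry) : Decidable t.IsValid := inferInstanceAs (Decidable (_ ∧ _))

/-- Enough coefficients to separate the entries of the table. -/
def key (t : Entry) : List (ZMod 3) :=
  [t.a, t.b, t.e, t.d].flatMap fun l => (List.range 5).map fun k => l.getD k 0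

theorem ofL_scaleL_two (l : List (ZMod 3)) : ofL (scaleL 2 l) = -ofL l := by
  rw [ofL_scaleL, C_two]
  linear_combination ofL l * three_eq_zero

theorem ofL_c (t : Entry) : ofL t.c = t.mat 1 0 := by
  simp only [c, mat, ofL_mulL, ofL_cons, ofL_nil, C_two, Polynomial.C_0, Polynomial.C_1,
    Matrix.of_apply, Matrix.cons_val', Matrix.cons_val_zero, Matrix.cons_val_one]
  linear_combination X ^ 2 * ofL t.e * three_eq_zero

theorem ofL_p (t : Entry) : ofL t.p = cuspFst t.mat := by
  rw [p, ofL_addL, ofL_scaleL_two, ofL_c, cuspFst]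
  simp [mat, sub_eq_add_neg]

theorem ofL_q (t : Entry) : ofL t.q = cuspSnd t.mat := by
  rw [q, ofL_addL, ofL_scaleL_two, cuspSnd]
  simp [mat, sub_eq_add_neg]

theorem ofL_det (t : Entry) : ofL t.det = t.mat.det := by
  rw [det, ofL_addL, ofL_scaleL_two, ofL_mulL, ofL_mulL, ofL_c, Matrix.det_fin_two]
  simp [mat, sub_eq_add_neg]

theorem IsValid.mat_mem {t : Entry} (h : t.IsValid) : t.mat ∈ Gamma0TTT := by
  refine ⟨?_, ofL t.e, by simp [mat]⟩
  rcases Bool.or_eq_true _ _ ▸ h.1 with h | h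
  · exact ⟨1, by decide, by simp [← ofL_det, ofL_eq_of_eqvL h]⟩
  · exact ⟨2, by decide, by simp [← ofL_det, ofL_eq_of_eqvL h]⟩

theorem IsValid.alphaFst_cusp {t : Entry} (h : t.IsValid) :
    alphaFst (cuspFst t.mat) (cuspSnd t.mat) = X * ofL t.x := by
  rw [← ofL_p, ← ofL_q, ← ofL_alphaFstL, ofL_eq_of_eqvL h.2.1]
  simp

theorem IsValid.alphaSnd_cusp {t : Entry} (h : t.IsValid) :
    alphaSnd (cuspFst t.mat) (cuspSnd t.mat) = ofL t.y := by
  rw [← ofL_p, ← ofL_q, ← ofL_alphaSndL, ofL_eq_of_eqvL h.2.2]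

theorem key_eq {s t : Entry} (h : s.mat = t.mat) : s.key = t.key := by
  have hc (l m : List (ZMod 3)) (hlm : ofL l = ofL m) (k : ℕ) : l.getD k 0 = m.getD k 0 := by
    rw [← coeff_ofL, ← coeff_ofL, hlm]
  have ha := congrFun (congrFun h 0) 0
  have hb := congrFun (congrFun h 0) 1
  have he := congrFun (congrFun h 1) 0
  have hd := congrFun (congrFun h 1) 1
  simp only [mat, Matrix.of_apply, Matrix.cons_val', Matrix.cons_val_zero, Matrix.cons_val_one,
    Matrix.cons_val_fin_one] at ha hb he hd
  have hne : (X ^ 3 - X ^ 2 : (ZMod 3)[X]) ≠ 0 :=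
    Polynomial.Monic.ne_zero (by monicity!)
  simp only [key, hc _ _ ha, hc _ _ hb, hc _ _ (mul_left_cancel₀ hne he), hc _ _ hd,
    List.flatMap_cons]

end Entry

theorem isValid_of_mem_table : ∀ t ∈ table, t.IsValid := by
  decide +kernel

theorem coeff_zero_of_mem_table : ∀ t ∈ table, t.d.getD 0 0 = 1 := by
  decide +kernel

theorem pairwise_key_table : table.Pairwise fun s t => s.key ≠ t.key := by
  decide +kernel

/-- The classes in `Γ/{±1}` of the matrices in the table. -/
noncomputable def tableClasses : List (Quotient pmSetoid) :=
  table.pmap (P := Entry.IsValid) (fun t h => Quotient.mk pmSetoid ⟨t.mat, Entry.IsValid.mat_mem h⟩)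
    isValid_of_mem_table

theorem nodup_tableClasses : tableClasses.Nodup := by
  rw [tableClasses, List.Nodup, List.pairwise_pmap]
  refine pairwise_key_table.imp_of_mem fun {s t} hs ht hst h₁ h₂ heq => ?_
  rcases Quotient.exact heq with h | h
  · exact hst (Entry.key_eq h.symm)
  · have h0 := congrArg (fun g => (g 1 1).coeff 0) h
    simp only [Entry.mat, Matrix.of_apply, Matrix.cons_val', Matrix.cons_val_one,
      Matrix.cons_val_fin_one, Matrix.neg_apply, Polynomial.coeff_neg, coeff_ofL,
      coeff_zero_of_mem_table s hs, coeff_zero_of_mem_table t ht] at h0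
    exact absurd h0 (by decide)

theorem neg_mem_Gamma {g : Matrix (Fin 2) (Fin 2) (ZMod 3)[X]} (hg : g ∈ Gamma0TTT) :
    -g ∈ Gamma0TTT := by
  refine ⟨?_, by rw [Matrix.neg_apply]; exact (dvd_neg).2 hg.2⟩
  obtain ⟨u, hu, h⟩ := hg.1
  exact ⟨u, hu, by rw [Matrix.det_neg, h]; simp⟩

theorem rowHeight_neg (x y : (ZMod 3)[X]) : rowHeight (-x) (-y) = rowHeight x y := by
  simp [rowHeight]

theorem cuspHeight_neg (g : Matrix (Fin 2) (Fin 2) (ZMod 3)[X]) :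
    cuspHeight (-g) = cuspHeight g := by
  rw [cuspHeight, cuspHeight, ← rowHeight_neg]
  congr 1 <;> simp only [alphaFst, alphaSnd, cuspFst, cuspSnd, Matrix.neg_apply] <;> ring

theorem mem_tableClasses {γ : ↥Gamma0TTT} (hd : (γ.1 1 1).coeff 0 = 1)
    (hh : rowHeight (γ.1 1 0) (γ.1 1 1) + cuspHeight γ.1 ≤ 8) :
    Quotient.mk pmSetoid γ ∈ tableClasses := by
  obtain ⟨t, ht, h1, h2, h3, h4⟩ := exists_mem_table γ.2 hd hh
  have hv := isValid_of_mem_table t ht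
  have he : γ.1 = t.mat :=
    eq_of_rows (by simpa [Entry.mat] using h1) (by simpa [Entry.mat] using h2)
    (by rw [h3, hv.alphaFst_cusp]) (by rw [h4, hv.alphaSnd_cusp])
  rw [tableClasses, List.mem_pmap]
  exact ⟨t, ht, congrArg _ (Subtype.ext he.symm)⟩

theorem zmodThree_eq_one_or : ∀ a : ZMod 3, a ≠ 0 → a = 1 ∨ -a = 1 := by decide

theorem mk_mem_tableClasses (γ : ↥Gamma0TTT)
    (hh : rowHeight (γ.1 1 0) (γ.1 1 1) + cuspHeight γ.1 ≤ 8) :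
    Quotient.mk pmSetoid γ ∈ tableClasses := by
  rcases zmodThree_eq_one_or _ (coeff_zero_lower_right γ.2) with h | h
  · exact mem_tableClasses h hh
  · have hγ : Quotient.mk pmSetoid γ = Quotient.mk pmSetoid ⟨-γ.1, neg_mem_Gamma γ.2⟩ :=
      Quotient.sound (Or.inr rfl)
    rw [hγ]
    refine mem_tableClasses (by simpa using h) ?_
    simpa only [Matrix.neg_apply, rowHeight_neg, cuspHeight_neg] using hh

end TableMatrices

section Approximation

theorem ofL_take_add_drop (k : ℕ) (p : List (ZMod 3)) :
    ofL (p.take k) + X ^ k * ofL (p.drop k) = ofL p := by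
  induction k generalizing p with
  | zero => simp
  | succ k ih =>
    cases p with
    | nil => simp
    | cons a p =>
      rw [List.take_succ_cons, List.drop_succ_cons, ofL_cons, ofL_cons, ← ih p]
      ring

theorem natDegree_ofL_drop_le {p : List (ZMod 3)} {k n : ℕ} (h : (ofL p).natDegree ≤ k + n) :
    (ofL (p.drop k)).natDegree ≤ n := by
  refine Polynomial.natDegree_le_iff_coeff_eq_zero.2 fun i hi => ?_
  have : (ofL p).coeff (k + i) = 0 := Polynomial.coeff_eq_zero_of_natDegree_lt (by omega)
  rw [coeff_ofL] at this ⊢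
  simpa [List.getD] using this

/-- An approximation `T ^ exp (re + im ρ)` with `re` and `im` of degree at most two. -/
structure Approx where
  exp : ℕ
  re : List (ZMod 3)
  im : List (ZMod 3)
deriving DecidableEq

namespace Approx

/-- The product of two approximations. -/
def mul (A B : Approx) : Approx where
  exp := A.exp + B.exp + 2
  re := (addL (mulL A.re B.re) (scaleL 2 (mulL A.im B.im))).drop 2
  im := (addL (mulL A.re B.im) (mulL A.im B.re)).drop 2

/-- The leading terms of `rowVal` at a row given by lists without trailing zeros. -/
def ofRow (p q : List (ZMod 3)) : Approx where
  exp := max (p.length - 3) (q.length - 1)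
  re := (0 :: 0 :: q).drop (max (p.length - 3) (q.length - 1))
  im := p.drop (max (p.length - 3) (q.length - 1))

/-- The leading terms of `T²` times a product of values `rowVal`. -/
def ofRows (l : List (List (ZMod 3) × List (ZMod 3))) : Approx :=
  l.foldr (fun r A => A.mul (ofRow (trimL r.1) (trimL r.2))) ⟨0, [0, 0, 1], []⟩

variable {K : Type*} [NormedField K]

noncomputable def eval (φ : (ZMod 3)[X] →+* K) (ρ : K) (A : Approx) : K :=
  φ (ofL A.re) + φ (ofL A.im) * ρ

/-- `A` approximates `z` with error at most `3 ^ (A.exp - 1)`. -/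
structure IsApprox (φ : (ZMod 3)[X] →+* K) (ρ : K) (A : Approx) (z : K) : Prop where
  natDegree_re : (ofL A.re).natDegree ≤ 2
  natDegree_im : (ofL A.im).natDegree ≤ 2
  norm_sub_le : ‖z - φ X ^ A.exp * A.eval φ ρ‖ ≤ 3 ^ A.exp / 3

variable [IsUltrametricDist K] {φ : (ZMod 3)[X] →+* K} {ρ : K} (hφ : ‖φ X‖ = 3)
  (hρ : ρ ^ 2 + 1 = 0)

include hφ

theorem norm_ofL_take_le (p : List (ZMod 3)) (k : ℕ) : ‖φ (ofL (p.take k))‖ ≤ 3 ^ k / 3 := by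
  cases k with
  | zero => simp
  | succ k =>
    rw [pow_succ, mul_div_cancel_right₀ _ (by norm_num)]
    exact norm_map_le hφ (natDegree_ofL_le (List.length_take_le _ _))

include hρ

omit hφ in
theorem norm_add_mul_le {a b : K} {r : ℝ} (ha : ‖a‖ ≤ r) (hb : ‖b‖ ≤ r) : ‖a + b * ρ‖ ≤ r := by
  refine (IsUltrametricDist.norm_add_le_max _ _).trans (max_le ha ?_)
  rwa [norm_mul, norm_sqrt_neg_one hρ, mul_one]

theorem IsApprox.norm_eval_le {A : Approx} {z : K} (h : A.IsApprox φ ρ z) :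
    ‖A.eval φ ρ‖ ≤ 3 ^ 2 :=
  norm_add_mul_le hρ (norm_map_le hφ h.natDegree_re) (norm_map_le hφ h.natDegree_im)

theorem IsApprox.norm_le {A : Approx} {z : K} (h : A.IsApprox φ ρ z) :
    ‖z‖ ≤ 3 ^ A.exp * 3 ^ 2 := by
  have e : z = (z - φ X ^ A.exp * A.eval φ ρ) + φ X ^ A.exp * A.eval φ ρ := by ring
  rw [e]
  refine (IsUltrametricDist.norm_add_le_max _ _).trans (max_le (h.norm_sub_le.trans ?_) ?_)
  · have : (0 : ℝ) < 3 ^ A.exp := by positivity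
    linarith
  · rw [norm_mul, norm_pow, hφ]
    gcongr
    exact h.norm_eval_le hφ hρ

theorem norm_eval_mul_sub_le (A B : Approx) :
    ‖A.eval φ ρ * B.eval φ ρ - φ X ^ 2 * (A.mul B).eval φ ρ‖ ≤ 3 := by
  set P := addL (mulL A.re B.re) (scaleL 2 (mulL A.im B.im)) with hP
  set Q := addL (mulL A.re B.im) (mulL A.im B.re) with hQ
  have e : A.eval φ ρ * B.eval φ ρ - φ X ^ 2 * (A.mul B).eval φ ρ
      = φ (ofL (P.take 2)) + φ (ofL (Q.take 2)) * ρ := by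
    have h1 := congrArg φ (ofL_take_add_drop 2 P)
    have h2 := congrArg φ (ofL_take_add_drop 2 Q)
    rw [map_add, map_mul, map_pow, hP, ofL_addL, Entry.ofL_scaleL_two, ofL_mulL, ofL_mulL, map_add,
      map_neg, map_mul, map_mul, ← hP] at h1
    rw [map_add, map_mul, map_pow, hQ, ofL_addL, ofL_mulL, ofL_mulL, map_add, map_mul, map_mul,
      ← hQ] at h2
    simp only [eval, mul, ← hP, ← hQ]
    linear_combination -h1 - ρ * h2 + φ (ofL A.im) * φ (ofL B.im) * hρ
  rw [e]
  refine norm_add_mul_le hρ ?_ ?_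
  all_goals exact (norm_ofL_take_le hφ _ 2).trans (by norm_num)

theorem IsApprox.mul {A B : Approx} {z w : K} (hA : A.IsApprox φ ρ z) (hB : B.IsApprox φ ρ w) :
    (A.mul B).IsApprox φ ρ (z * w) where
  natDegree_re := by
    refine natDegree_ofL_drop_le ?_
    rw [ofL_addL, Entry.ofL_scaleL_two, ofL_mulL, ofL_mulL]
    have h1 := hA.natDegree_re
    have h2 := hA.natDegree_im
    have h3 := hB.natDegree_re
    have h4 := hB.natDegree_im
    exact (Polynomial.natDegree_add_le _ _).trans
      (max_le (Polynomial.natDegree_mul_le.trans (by omega))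
        ((Polynomial.natDegree_neg _).le.trans (Polynomial.natDegree_mul_le.trans (by omega))))
  natDegree_im := by
    refine natDegree_ofL_drop_le ?_
    rw [ofL_addL, ofL_mulL, ofL_mulL]
    have h1 := hA.natDegree_re
    have h2 := hA.natDegree_im
    have h3 := hB.natDegree_re
    have h4 := hB.natDegree_im
    exact (Polynomial.natDegree_add_le _ _).trans
      (max_le (Polynomial.natDegree_mul_le.trans (by omega))
        (Polynomial.natDegree_mul_le.trans (by omega)))
  norm_sub_le := by
    have e : z * w - φ X ^ (A.mul B).exp * (A.mul B).eval φ ρ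
        = (z - φ X ^ A.exp * A.eval φ ρ) * w
          + (φ X ^ A.exp * A.eval φ ρ * (w - φ X ^ B.exp * B.eval φ ρ)
            + φ X ^ A.exp * φ X ^ B.exp
              * (A.eval φ ρ * B.eval φ ρ - φ X ^ 2 * (A.mul B).eval φ ρ)) := by
      simp only [Approx.mul, pow_add]
      ring
    have hexp : (3 : ℝ) ^ (A.mul B).exp / 3 = 3 ^ A.exp * 3 ^ B.exp * 3 := by
      simp only [Approx.mul, pow_add]
      ring
    rw [e, hexp]
    refine (IsUltrametricDist.norm_add_le_max _ _).trans (max_le ?_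
      ((IsUltrametricDist.norm_add_le_max _ _).trans (max_le ?_ ?_)))
    · rw [norm_mul]
      calc _ ≤ 3 ^ A.exp / 3 * ((3 : ℝ) ^ B.exp * 3 ^ 2) :=
            mul_le_mul hA.norm_sub_le (hB.norm_le hφ hρ) (norm_nonneg _) (by positivity)
        _ = _ := by ring
    · rw [norm_mul, norm_mul, norm_pow, hφ]
      calc _ ≤ 3 ^ A.exp * 3 ^ 2 * ((3 : ℝ) ^ B.exp / 3) :=
            mul_le_mul (by gcongr; exact hA.norm_eval_le hφ hρ) hB.norm_sub_le (norm_nonneg _)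
              (by positivity)
        _ = _ := by ring
    · rw [norm_mul, norm_mul, norm_pow, norm_pow, hφ]
      gcongr
      exact norm_eval_mul_sub_le hφ hρ A B

theorem isApprox_ofRow (p q : List (ZMod 3)) :
    (ofRow p q).IsApprox φ ρ (rowVal φ ρ (ofL p) (ofL q)) where
  natDegree_re := by
    refine natDegree_ofL_le ?_
    simp only [ofRow, List.length_drop, List.length_cons]
    omega
  natDegree_im := by
    refine natDegree_ofL_le ?_
    simp only [ofRow, List.length_drop]
    omega
  norm_sub_le := by
    set k := max (p.length - 3) (q.length - 1) with hk
    have e : rowVal φ ρ (ofL p) (ofL q) - φ X ^ (ofRow p q).exp * (ofRow p q).eval φ ρ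
        = φ (ofL ((0 :: 0 :: q).take k)) + φ (ofL (p.take k)) * ρ := by
      have h1 := congrArg φ (ofL_take_add_drop k (0 :: 0 :: q))
      have h2 := congrArg φ (ofL_take_add_drop k p)
      simp only [map_add, map_mul, map_pow, ofL_cons, map_zero, zero_add] at h1 h2
      simp only [rowVal, eval, ofRow, ← hk]
      linear_combination -h1 - ρ * h2
    rw [e]
    exact norm_add_mul_le hρ (norm_ofL_take_le hφ _ _) (norm_ofL_take_le hφ _ _)

theorem isApprox_ofRows (l : List (List (ZMod 3) × List (ZMod 3))) :
    (ofRows l).IsApprox φ ρ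
      (φ X ^ 2 * (l.map fun r => rowVal φ ρ (ofL r.1) (ofL r.2)).prod) := by
  induction l with
  | nil =>
    refine ⟨natDegree_ofL_le (by simp [ofRows]), natDegree_ofL_le (by simp [ofRows]), ?_⟩
    simp [ofRows, eval, pow_two]
  | cons r l ih =>
    have h := ih.mul hφ hρ (isApprox_ofRow hφ hρ (trimL r.1) (trimL r.2))
    rw [ofL_trimL, ofL_trimL] at h
    have e : ofRows (r :: l) = (ofRows l).mul (ofRow (trimL r.1) (trimL r.2)) := rfl
    rw [e, List.map_cons, List.prod_cons]
    convert h using 1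
    ring

end Approx

/-- The rows whose values are multiplied in the numerators. -/
def numRows : List (List (ZMod 3) × List (ZMod 3)) :=
  table.map (fun t => (t.p, t.q)) ++ table.map fun t => (alphaFstL t.c t.d, alphaSndL t.c t.d)

/-- The rows whose values are multiplied in the denominators. -/
def denRows : List (List (ZMod 3) × List (ZMod 3)) :=
  table.map (fun t => (t.c, t.d)) ++ table.map fun t => (0 :: t.x, t.y)

variable {K : Type*} [NormedField K] {φ : (ZMod 3)[X] →+* K} {ρ : K}

theorem prod_numRows : (numRows.map fun r => rowVal φ ρ (ofL r.1) (ofL r.2)).prod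
    = (table.map fun t => factorNum φ ρ t.mat).prod := by
  rw [numRows, List.map_append, List.prod_append, List.map_map, List.map_map, ← List.prod_map_mul]
  refine congrArg _ (List.map_congr_left fun t _ => ?_)
  simp only [Function.comp, factorNum, Entry.ofL_p, Entry.ofL_q, ofL_alphaFstL, ofL_alphaSndL,
    Entry.ofL_c]
  rfl

theorem prod_denRows : (denRows.map fun r => rowVal φ ρ (ofL r.1) (ofL r.2)).prod
    = (table.map fun t => factorDen φ ρ t.mat).prod := by
  rw [denRows, List.map_append, List.prod_append, List.map_map, List.map_map, ← List.prod_map_mul]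
  refine congrArg _ (List.map_congr_left fun t ht => ?_)
  have hv := isValid_of_mem_table t ht
  simp only [Function.comp, factorDen, hv.alphaFst_cusp, hv.alphaSnd_cusp, Entry.ofL_c, ofL_cons,
    map_zero, zero_add]
  rfl

theorem ofRows_numRows : Approx.ofRows numRows = ⟨354, [2, 2, 0], [1, 2, 2]⟩ := by
  decide +kernel

theorem ofRows_denRows : Approx.ofRows denRows = ⟨353, [0, 2, 0], [2, 0, 2]⟩ := by
  decide +kernel

theorem prod_map_div_list {ι : Type*} (f g : ι → K) (l : List ι) :
    (l.map fun i => f i / g i).prod = (l.map f).prod / (l.map g).prod := by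
  induction l with
  | nil => simp
  | cons i l ih => simp only [List.map_cons, List.prod_cons, ih, div_mul_div_comm]

theorem map_three : φ 3 = 0 := by rw [three_eq_zero, map_zero]

variable [IsUltrametricDist K] (hφ : ‖φ X‖ = 3) (hρ : ρ ^ 2 + 1 = 0)

include hφ hρ

theorem Approx.norm_div_sub_le {k : ℕ} {N D : K}
    (hN : Approx.IsApprox φ ρ ⟨k + 1, [2, 2, 0], [1, 2, 2]⟩ (φ X ^ 2 * N))
    (hD : Approx.IsApprox φ ρ ⟨k, [0, 2, 0], [2, 0, 2]⟩ (φ X ^ 2 * D)) :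
    ‖N / D - (φ X + 1 + (φ X)⁻¹)‖ ≤ 1 / 9 := by
  have ht := map_X_ne_zero hφ
  have hN' := hN.norm_sub_le
  have hD' := hD.norm_sub_le
  set A := Approx.eval φ ρ ⟨k + 1, [2, 2, 0], [1, 2, 2]⟩ with hA
  set B := Approx.eval φ ρ ⟨k, [0, 2, 0], [2, 0, 2]⟩ with hB
  have hBnorm : 3 ^ 2 ≤ ‖B‖ := by
    have hy : ofL [0, 2, 0] ≠ 0 := fun h => by
      have h1 := coeff_ofL [0, 2, 0] 1
      rw [h] at h1
      exact absurd h1 (by decide)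
    have hx : 2 ≤ (ofL [2, 0, 2]).natDegree :=
      Polynomial.le_natDegree_of_ne_zero (by rw [coeff_ofL]; decide)
    rw [hB, Approx.eval, add_comm, norm_map_mul_add hφ hρ hy]
    exact pow_le_pow_right₀ (by norm_num) (hx.trans (le_max_left _ _))
  have hAB : ‖φ X ^ 2 * A - (φ X ^ 2 + φ X + 1) * B‖ ≤ 3 := by
    have e : φ X ^ 2 * A - (φ X ^ 2 + φ X + 1) * B = φ X + φ (X + 1) * ρ := by
      have h3 := map_three (φ := φ)
      rw [map_ofNat] at h3
      simp only [hA, hB, Approx.eval, ofL_cons, ofL_nil, map_add, map_mul, map_zero, map_one,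
        map_ofNat]
      linear_combination (-φ X - (φ X ^ 2 + φ X + 1) * ρ) * h3
    rw [e]
    refine Approx.norm_add_mul_le hρ hφ.le ?_
    exact (norm_map_le (n := 1) hφ (by compute_degree)).trans_eq (pow_one 3)
  have hDnorm : 3 ^ k ≤ ‖D‖ := by
    by_contra! hlt
    have e : φ X ^ k * B = φ X ^ 2 * D - (φ X ^ 2 * D - φ X ^ k * B) := by ring
    have h1 : ‖φ X ^ k * B‖ < 3 ^ k * 3 ^ 2 := by
      rw [e, sub_eq_add_neg]
      refine (IsUltrametricDist.norm_add_le_max _ _).trans_lt (max_lt ?_ ?_)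
      · rw [norm_mul, norm_pow, hφ]
        linarith
      · rw [norm_neg]
        have : (0 : ℝ) < 3 ^ k := by positivity
        exact hD'.trans_lt (by dsimp only; linarith)
    rw [norm_mul, norm_pow, hφ] at h1
    have := lt_of_mul_lt_mul_left h1 (by positivity)
    linarith
  have hD0 : D ≠ 0 := by
    rw [← norm_pos_iff]
    exact lt_of_lt_of_le (by positivity) hDnorm
  have hdiff : ‖φ X ^ 2 * (φ X * N - (φ X ^ 2 + φ X + 1) * D)‖ ≤ 3 ^ k * 3 := by
    have e : φ X ^ 2 * (φ X * N - (φ X ^ 2 + φ X + 1) * D)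
        = φ X * (φ X ^ 2 * N - φ X ^ (k + 1) * A)
          + (-(φ (X ^ 2 + X + 1) * (φ X ^ 2 * D - φ X ^ k * B))
            + φ X ^ k * (φ X ^ 2 * A - (φ X ^ 2 + φ X + 1) * B)) := by
      rw [map_add, map_add, map_pow, map_one]
      ring
    rw [e]
    refine (IsUltrametricDist.norm_add_le_max _ _).trans (max_le ?_
      ((IsUltrametricDist.norm_add_le_max _ _).trans (max_le ?_ ?_)))
    · rw [norm_mul, hφ]
      calc _ ≤ 3 * ((3 : ℝ) ^ (k + 1) / 3) := by gcongr
        _ = _ := by rw [pow_succ]; ring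
    · rw [norm_neg, norm_mul]
      calc _ ≤ (3 : ℝ) ^ 2 * (3 ^ k / 3) := by
            gcongr
            exact norm_map_le hφ (by compute_degree)
        _ = _ := by ring
    · rw [norm_mul, norm_pow, hφ]
      gcongr
  have e : N / D - (φ X + 1 + (φ X)⁻¹)
      = φ X ^ 2 * (φ X * N - (φ X ^ 2 + φ X + 1) * D) / (φ X ^ 3 * D) := by
    field_simp
  rw [e, norm_div, norm_mul (φ X ^ 3), norm_pow, hφ,
    div_le_iff₀ (mul_pos (by norm_num) (norm_pos_iff.2 hD0))]
  linarith

theorem norm_prod_table_sub_le :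
    ‖(table.map fun t => factorNum φ ρ t.mat / factorDen φ ρ t.mat).prod
      - (φ X + 1 + (φ X)⁻¹)‖ ≤ 1 / 9 := by
  have hN := Approx.isApprox_ofRows hφ hρ numRows
  have hD := Approx.isApprox_ofRows hφ hρ denRows
  rw [ofRows_numRows] at hN
  rw [ofRows_denRows] at hD
  rw [prod_map_div_list, ← prod_numRows, ← prod_denRows]
  exact Approx.norm_div_sub_le hφ hρ hN hD

end Approximation

section Final

theorem norm_polyEmb3_X {C : Type*} [NormedField C] [Algebra (LaurentSeries (ZMod 3)) C]
    (hext : ∀ x : LaurentSeries (ZMod 3), ‖algebraMap (LaurentSeries (ZMod 3)) C x‖ = absK3 x) :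
    ‖polyEmb3 C X‖ = 3 := by
  have h : polyEmb3 C X = algebraMap (LaurentSeries (ZMod 3)) C Tel3 := by
    simp [polyEmb3]
  have h0 : (1 : ZMod 3) ≠ 0 := by decide
  rw [h, hext, absK3, if_neg (by simp [Tel3]), Tel3, HahnSeries.order_single h0]
  norm_num

theorem act3_alpha3 {C : Type*} [NormedField C] [Algebra (LaurentSeries (ZMod 3)) C] {ρ : C}
    (ht : polyEmb3 C X ≠ 0) :
    act3 alpha3 ((polyEmb3 C X)⁻¹ ^ 2 * ρ)
      = rowVal (polyEmb3 C) ρ (alphaFst 1 0) (alphaSnd 1 0)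
        / rowVal (polyEmb3 C) ρ (alphaFst 0 1) (alphaSnd 0 1) := by
  rw [act3, moebius_eq_rowVal_div ht]
  simp [alpha3, alphaFst, alphaSnd]

end Final

/-- **Part of the Proposition in Section 8.2.**  With `ω = T⁻²·ρ` (`ρ² + 1 = 0`), the
family `γ ↦ (1/T - γω)/(1/T - γ(αω))`, indexed by `Γ~ = Γ/{±I}`, is multipliable, and
its product `u_α(1/T)` satisfies `|u_α(1/T) - (π⁻¹ + 1 + π)| < 3⁻¹`, `π = 1/T` (so
`π⁻¹ = T`). -/
theorem u_alpha3_at_one_over_T {C : Type*} [NormedField C] [CompleteSpace C]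
    [Algebra (LaurentSeries (ZMod 3)) C]
    (hna : ∀ x y : C, ‖x + y‖ ≤ max ‖x‖ ‖y‖)
    (hext : ∀ x : LaurentSeries (ZMod 3), ‖algebraMap (LaurentSeries (ZMod 3)) C x‖ = absK3 x)
    (ρ : C) (hρ : ρ ^ 2 + 1 = 0)
    (ω : C) (hω : ω = (polyEmb3 C Polynomial.X)⁻¹ ^ 2 * ρ)
    (s : C) (hs : s = (polyEmb3 C Polynomial.X)⁻¹)
    (f : Quotient pmSetoid → C)
    (hf : ∀ γ : ↥Gamma0TTT, f (Quotient.mk pmSetoid γ)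
      = (s - act3 γ.val ω) / (s - act3 γ.val (act3 alpha3 ω))) :
    Multipliable f ∧
    ‖(∏' x, f x) - (polyEmb3 C Polynomial.X + 1 + (polyEmb3 C Polynomial.X)⁻¹)‖ < (3 : ℝ) ^ (-1 : ℤ) := by
  have : IsUltrametricDist C :=
    IsUltrametricDist.isUltrametricDist_of_forall_norm_add_le_max_norm hna
  have hφ : ‖polyEmb3 C X‖ = 3 := norm_polyEmb3_X hext
  have hf' (γ : ↥Gamma0TTT) : f (Quotient.mk pmSetoid γ)
      = factorNum (polyEmb3 C) ρ γ.1 / factorDen (polyEmb3 C) ρ γ.1 := by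
    rw [hf, hs, hω, ← factor_eq hφ hρ γ.2 (act3_alpha3 (map_X_ne_zero hφ))]
    rfl
  have hmul : Multipliable f := by
    refine multipliable_of_finite_norm_sub_one fun ε hε => ?_
    obtain ⟨n, hn⟩ := pow_unbounded_of_one_lt (3 ^ 6 / ε) (by norm_num : (1 : ℝ) < 3)
    refine (((finite_height_le n).preimage Subtype.val_injective.injOn).image
      (Quotient.mk pmSetoid)).subset fun q hq => ?_
    induction q using Quotient.inductionOn with
    | h γ =>
      refine ⟨γ, height_le_of_lt_norm hφ hρ γ.2 ?_, rfl⟩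
      rw [Set.mem_ofPred_eq, hf'] at hq
      rw [div_lt_iff₀ hε] at hn
      calc (3 : ℝ) ^ 6 < 3 ^ n * ε := hn
        _ ≤ 3 ^ (n + 1) * ‖factorNum (polyEmb3 C) ρ γ.1 / factorDen (polyEmb3 C) ρ γ.1 - 1‖ := by
          gcongr
          · norm_num
          · omega
        _ = _ := mul_comm _ _
  refine ⟨hmul, ?_⟩
  set S : Finset (Quotient pmSetoid) := tableClasses.toFinset with hS
  have hout : ∀ q ∉ S, ‖f q - 1‖ ≤ 1 / 27 := fun q hq => by
    induction q using Quotient.inductionOn with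
    | h γ =>
      by_contra! hlt
      refine hq (List.mem_toFinset.2 (mk_mem_tableClasses γ (height_le_of_lt_norm hφ hρ γ.2 ?_)))
      rw [← hf']
      calc (3 : ℝ) ^ 6 = 1 / 27 * 3 ^ (8 + 1) := by norm_num
        _ < ‖f ⟦γ⟧ - 1‖ * 3 ^ (8 + 1) := by gcongr
  have hprod : ∏ q ∈ S, f q
      = (table.map fun t =>
          factorNum (polyEmb3 C) ρ t.mat / factorDen (polyEmb3 C) ρ t.mat).prod := by
    rw [hS, List.prod_toFinset _ nodup_tableClasses, tableClasses, List.map_pmap]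
    simp only [hf', List.pmap_eq_map]
  have h1 := norm_prod_table_sub_le hφ hρ
  rw [← hprod] at h1
  set P := ∏ q ∈ S, f q
  set L := polyEmb3 C X + 1 + (polyEmb3 C X)⁻¹ with hL
  have hLnorm : ‖L‖ ≤ 3 := by
    refine (hna _ _).trans (max_le ((hna _ _).trans (max_le hφ.le ?_)) ?_)
    · rw [norm_one]; norm_num
    · rw [norm_inv, hφ]; norm_num
  have hP : ‖P‖ ≤ 3 := by
    rw [← sub_add_cancel P L]
    exact (hna _ _).trans (max_le (h1.trans (by norm_num)) hLnorm)
  have h2 := norm_tprod_sub_le hmul (by norm_num) (by norm_num) S hout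
  rw [← sub_add_sub_cancel _ P L]
  refine (hna _ _).trans_lt (max_lt ?_ (h1.trans_lt (by norm_num)))
  calc _ ≤ 1 / 27 * ‖P‖ := h2
    _ ≤ 1 / 27 * 3 := by gcongr
    _ < _ := by norm_num
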